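/- Let N ≥ 2, set d = N², let ρ ∈ ℝ^N have coordinates ρ_j = (N+1)/2 − j for 1 ≤ j ≤ N, and define the multiplicity polynomial m(x) = ∏_{1≤j<k≤N} (x_j − x_k)²/(k−j)² for x ∈ ℝ^N. Define, for λ > 0, 𝓝(λ) = (1/N!) Σ_{b∈ℤ^N} m(b+ρ) · 1_{|b+ρ|² ≤ λ + |ρ|²}. Then as λ → ∞, 𝓝(λ) = C λ^{d/2} + O(λ^{N(N+2)(N−1)/(2(N+1))}), where C = (1/N!) ∫_{|x|≤1} m(x) dx. In particular, since N(N+2)(N−1)/(2(N+1)) < (d−1)/2, the Avakumovic–Hörmander remainder exponent (d−1)/2 in Weyl's law is not sharp for this counting function (which is the spectral counting function of the Laplace–Beltrami operator on the unitary group U(N) with its bi-invariant metric). -/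

import Mathlib

open MeasureTheory Filter Asymptotics Finset

/-- The oscillating factor `exp(-i s cos θ)`. -/
noncomputable def cosPhase (s θ : ℝ) : ℂ := Complex.exp (-(s * Real.cos θ : ℝ) * Complex.I)

lemma norm_cosPhase (s θ : ℝ) : ‖cosPhase s θ‖ = 1 := by
  rw [cosPhase, ← Complex.ofReal_neg, Complex.norm_exp_ofReal_mul_I]

lemma continuous_cosPhase (s : ℝ) : Continuous (cosPhase s) := by
  unfold cosPhase; fun_prop

lemma hasDerivAt_cosPhase (s θ : ℝ) :
    HasDerivAt (cosPhase s) (s * Complex.I * Real.sin θ * cosPhase s θ) θ := by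
  have h1 : HasDerivAt (fun θ : ℝ => (-(s * Real.cos θ : ℝ) : ℂ) * Complex.I)
      ((-(s * (-Real.sin θ) : ℝ) : ℂ) * Complex.I) θ :=
    (((Real.hasDerivAt_cos θ).const_mul s).ofReal_comp.neg).mul_const _
  refine HasDerivAt.congr_deriv (f := cosPhase s) h1.cexp ?_
  simp only [cosPhase]
  push_cast
  ring

lemma cosPhase_integral_by_parts (s : ℝ) {a b : ℝ} {u u' : ℝ → ℝ}
    (hu : ∀ θ ∈ Set.uIcc a b, HasDerivAt u (u' θ) θ) (hu' : ContinuousOn u' (Set.uIcc a b)) :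
    s * Complex.I * ∫ θ in a..b, ((u θ * Real.sin θ : ℝ) : ℂ) * cosPhase s θ =
      u b * cosPhase s b - u a * cosPhase s a - ∫ θ in a..b, (u' θ : ℂ) * cosPhase s θ := by
  rw [← intervalIntegral.integral_mul_deriv_eq_deriv_mul
    (u := fun θ => (u θ : ℂ)) (u' := fun θ => (u' θ : ℂ))
    (v' := fun θ => s * Complex.I * Real.sin θ * cosPhase s θ)
    (fun θ hθ => (hu θ hθ).ofReal_comp) (fun θ _ => hasDerivAt_cosPhase s θ),
    ← intervalIntegral.integral_const_mul]
  · congr 1; ext θ; push_cast; ring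
  · exact (Complex.continuous_ofReal.comp_continuousOn hu').intervalIntegrable
  · have := continuous_cosPhase s
    exact Continuous.intervalIntegrable (by fun_prop) _ _

lemma norm_integral_mul_cosPhase_le (s : ℝ) {a b M : ℝ} {u : ℝ → ℝ} (hab : a ≤ b)
    (hu : ∀ θ ∈ Set.Icc a b, |u θ| ≤ M) :
    ‖∫ θ in a..b, (u θ : ℂ) * cosPhase s θ‖ ≤ M * (b - a) := by
  rw [← abs_of_nonneg (sub_nonneg.2 hab)]
  refine intervalIntegral.norm_integral_le_of_norm_le_const fun θ hθ => ?_
  rw [Set.uIoc_of_le hab] at hθ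
  rw [norm_mul, norm_cosPhase, mul_one, Complex.norm_real]
  exact hu θ ⟨hθ.1.le, hθ.2⟩

lemma abs_cos_pow_mul_sin_pow_le (k μ : ℕ) (θ : ℝ) : |Real.cos θ ^ k * Real.sin θ ^ μ| ≤ 1 := by
  rw [abs_mul, abs_pow, abs_pow]
  exact mul_le_one₀ (pow_le_one₀ (abs_nonneg _) (Real.abs_cos_le_one _)) (by positivity)
    (pow_le_one₀ (abs_nonneg _) (Real.abs_sin_le_one _))

lemma norm_integral_cos_pow_cosPhase_middle (k : ℕ) {s ε : ℝ} (hs : 0 < s) (hε : 0 < ε)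
    (hε1 : ε ≤ 1) :
    ‖∫ θ in ε..(Real.pi - ε), ((Real.cos θ ^ k : ℝ) : ℂ) * cosPhase s θ‖ ≤
      (2 * Real.pi / ε + k * Real.pi) / s := by
  have hpi := Real.pi_gt_three
  have hle : ε ≤ Real.pi - ε := by linarith
  have hpos : ∀ θ ∈ Set.uIcc ε (Real.pi - ε), 0 < Real.sin θ := by
    intro θ hθ
    rw [Set.uIcc_of_le hle] at hθ
    exact Real.sin_pos_of_pos_of_lt_pi (by linarith [hθ.1]) (by linarith [hθ.2])
  have hsin : 2 / Real.pi * ε ≤ Real.sin ε := Real.mul_le_sin hε.le (by linarith)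
  have hinv : 1 / Real.sin ε ≤ Real.pi / (2 * ε) := by
    rw [div_le_div_iff₀ (by have := hpos ε (by simp); exact this) (by positivity)]
    have := mul_le_mul_of_nonneg_left hsin Real.pi_pos.le
    have e : Real.pi * (2 / Real.pi * ε) = 2 * ε := by field_simp
    linarith
  set u : ℝ → ℝ := fun θ => Real.cos θ ^ k / Real.sin θ
  set u' : ℝ → ℝ := fun θ => (k * Real.cos θ ^ (k - 1) * (-Real.sin θ) * Real.sin θ -
    Real.cos θ ^ k * Real.cos θ) / Real.sin θ ^ 2
  have hu : ∀ θ ∈ Set.uIcc ε (Real.pi - ε), HasDerivAt u (u' θ) θ := fun θ hθ =>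
    ((Real.hasDerivAt_cos θ).pow k).div (Real.hasDerivAt_sin θ) (hpos θ hθ).ne'
  have hu'c : ContinuousOn u' (Set.uIcc ε (Real.pi - ε)) :=
    ContinuousOn.div (by fun_prop) (by fun_prop) fun θ hθ => pow_ne_zero _ (hpos θ hθ).ne'
  have key := cosPhase_integral_by_parts s hu hu'c
  have hint : ∫ θ in ε..(Real.pi - ε), ((u θ * Real.sin θ : ℝ) : ℂ) * cosPhase s θ =
      ∫ θ in ε..(Real.pi - ε), ((Real.cos θ ^ k : ℝ) : ℂ) * cosPhase s θ := by
    refine intervalIntegral.integral_congr fun θ hθ => ?_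
    simp only [u]
    rw [div_mul_cancel₀ _ (hpos θ hθ).ne']
  rw [hint] at key
  have hub : ∀ θ, |u θ| ≤ 1 / |Real.sin θ| := fun θ => by
    simp only [u, abs_div]
    gcongr
    simpa using abs_cos_pow_mul_sin_pow_le k 0 θ
  have hcot : ∫ θ in ε..(Real.pi - ε), ((k : ℝ) + 1 / Real.sin θ ^ 2) ≤
      k * Real.pi + Real.pi / ε := by
    have hd : ∀ θ ∈ Set.uIcc ε (Real.pi - ε), HasDerivAt
        (fun θ => k * θ - Real.cos θ / Real.sin θ) ((k : ℝ) + 1 / Real.sin θ ^ 2) θ := by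
      intro θ hθ
      have := ((hasDerivAt_id θ).const_mul (k : ℝ)).sub
        ((Real.hasDerivAt_cos θ).div (Real.hasDerivAt_sin θ) (hpos θ hθ).ne')
      refine this.congr_deriv ?_
      have h1 : 1 / Real.sin θ ^ 2 = (Real.sin θ ^ 2 + Real.cos θ ^ 2) / Real.sin θ ^ 2 := by
        rw [Real.sin_sq_add_cos_sq]
      rw [h1]
      ring
    rw [intervalIntegral.integral_eq_sub_of_hasDerivAt hd]
    · rw [Real.cos_pi_sub, Real.sin_pi_sub]
      have h1 : Real.cos ε / Real.sin ε ≤ 1 / Real.sin ε := by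
        have := hpos ε (by simp)
        gcongr
        exact Real.cos_le_one ε
      have e : Real.pi / ε = 2 * (Real.pi / (2 * ε)) := by field_simp
      have : (k : ℝ) * (Real.pi - ε) - k * ε ≤ k * Real.pi := by
        have : 0 ≤ (k : ℝ) * ε := by positivity
        nlinarith
      rw [e, neg_div]
      linarith
    · refine ContinuousOn.intervalIntegrable ?_
      exact continuousOn_const.add (ContinuousOn.div (by fun_prop) (by fun_prop)
        fun θ hθ => pow_ne_zero _ (hpos θ hθ).ne')
  have hu'i : ‖∫ θ in ε..(Real.pi - ε), (u' θ : ℂ) * cosPhase s θ‖ ≤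
      k * Real.pi + Real.pi / ε := by
    refine le_trans ?_ hcot
    refine intervalIntegral.norm_integral_le_of_norm_le hle ?_ ?_
    · refine ae_of_all _ fun θ hθ => ?_
      have hθ' : θ ∈ Set.uIcc ε (Real.pi - ε) := by
        rw [Set.uIcc_of_le hle]; exact ⟨hθ.1.le, hθ.2⟩
      have hp := hpos θ hθ'
      rw [norm_mul, norm_cosPhase, mul_one, Complex.norm_real, Real.norm_eq_abs]
      have e : u' θ = -(k * Real.cos θ ^ (k - 1)) - Real.cos θ ^ (k + 1) / Real.sin θ ^ 2 := by
        simp only [u']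
        field_simp
        ring
      rw [e]
      refine (abs_sub _ _).trans ?_
      rw [abs_neg, abs_mul, abs_div, abs_of_nonneg (Nat.cast_nonneg k),
        abs_of_pos (pow_pos hp 2)]
      have h1 := abs_cos_pow_mul_sin_pow_le (k - 1) 0 θ
      have h2 := abs_cos_pow_mul_sin_pow_le (k + 1) 0 θ
      simp only [pow_zero, mul_one] at h1 h2
      gcongr
      exact mul_le_of_le_one_right (by positivity) h1
    · refine ContinuousOn.intervalIntegrable ?_
      exact continuousOn_const.add (ContinuousOn.div (by fun_prop) (by fun_prop)
        fun θ hθ => pow_ne_zero _ (hpos θ hθ).ne')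
  rw [le_div_iff₀ hs]
  have hn := congrArg norm key
  rw [norm_mul, norm_mul, Complex.norm_I, Complex.norm_real, Real.norm_of_nonneg hs.le,
    mul_one] at hn
  rw [mul_comm, hn]
  have hb1 : ‖(u (Real.pi - ε) : ℂ) * cosPhase s (Real.pi - ε)‖ ≤ Real.pi / (2 * ε) := by
    rw [norm_mul, norm_cosPhase, mul_one, Complex.norm_real, Real.norm_eq_abs]
    refine (hub _).trans ?_
    rwa [Real.sin_pi_sub, abs_of_pos (hpos ε (by simp))]
  have hb2 : ‖(u ε : ℂ) * cosPhase s ε‖ ≤ Real.pi / (2 * ε) := by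
    rw [norm_mul, norm_cosPhase, mul_one, Complex.norm_real, Real.norm_eq_abs]
    refine (hub _).trans ?_
    rwa [abs_of_pos (hpos ε (by simp))]
  refine (norm_sub_le _ _).trans ?_
  have := norm_sub_le ((u (Real.pi - ε) : ℂ) * cosPhase s (Real.pi - ε)) ((u ε : ℂ) * cosPhase s ε)
  have e : 2 * Real.pi / ε = Real.pi / (2 * ε) + Real.pi / (2 * ε) + Real.pi / ε := by
    field_simp; ring
  rw [e]
  linarith

lemma norm_integral_cos_pow_cosPhase_le (k : ℕ) {s : ℝ} (hs : 1 ≤ s) :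
    ‖∫ θ in (0 : ℝ)..Real.pi, ((Real.cos θ ^ k : ℝ) : ℂ) * cosPhase s θ‖ ≤
      (2 + 2 * Real.pi + k * Real.pi) * s ^ (-(1 / 2 : ℝ)) := by
  have hs0 : 0 < s := by linarith
  set ε := s ^ (-(1 / 2 : ℝ)) with hεdef
  have hε : 0 < ε := by positivity
  have hε1 : ε ≤ 1 := Real.rpow_le_one_of_one_le_of_nonpos hs (by norm_num)
  have hsε : 1 / s = ε * ε := by
    rw [hεdef, ← Real.rpow_add hs0]; norm_num [Real.rpow_neg_one]
  have hc : ∀ a b, IntervalIntegrable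
      (fun θ => ((Real.cos θ ^ k : ℝ) : ℂ) * cosPhase s θ) volume a b := fun a b =>
    Continuous.intervalIntegrable (by have := continuous_cosPhase s; fun_prop) _ _
  have hb : ∀ a b : ℝ, ∀ θ ∈ Set.Icc a b, |Real.cos θ ^ k| ≤ 1 := fun a b θ _ => by
    simpa using abs_cos_pow_mul_sin_pow_le k 0 θ
  rw [← intervalIntegral.integral_add_adjacent_intervals (hc 0 ε) (hc ε _),
    ← intervalIntegral.integral_add_adjacent_intervals (hc ε (Real.pi - ε)) (hc _ _)]
  have h1 := norm_integral_mul_cosPhase_le s hε.le (hb 0 ε)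
  have h2 := norm_integral_mul_cosPhase_le s (by linarith) (hb (Real.pi - ε) Real.pi)
  have h3 := norm_integral_cos_pow_cosPhase_middle k hs0 hε hε1
  have e : (2 * Real.pi / ε + k * Real.pi) / s = 2 * Real.pi * ε + k * Real.pi * (ε * ε) := by
    rw [div_eq_mul_one_div _ s, hsε]; field_simp
  rw [e] at h3
  have h4 : (k : ℝ) * Real.pi * (ε * ε) ≤ k * Real.pi * ε := by
    have : ε * ε ≤ ε := mul_le_of_le_one_left hε.le hε1
    gcongr
  refine (norm_add_le _ _).trans ?_
  refine (add_le_add_right (norm_add_le _ _) _).trans ?_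
  linarith

lemma exists_norm_integral_cos_sin_cosPhase_le (μ : ℕ) : ∀ k : ℕ, ∃ C : ℝ, ∀ s : ℝ, 1 ≤ s →
    ‖∫ θ in (0 : ℝ)..Real.pi, ((Real.cos θ ^ k * Real.sin θ ^ μ : ℝ) : ℂ) * cosPhase s θ‖ ≤
      C * s ^ (-((μ + 1 : ℝ) / 2)) := by
  induction μ using Nat.twoStepInduction with
  | zero =>
    intro k
    refine ⟨2 + 2 * Real.pi + k * Real.pi, fun s hs => ?_⟩
    simpa using norm_integral_cos_pow_cosPhase_le k hs
  | one =>
    intro k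
    refine ⟨2 + k * Real.pi, fun s hs => ?_⟩
    have hs0 : 0 < s := by linarith
    have key := cosPhase_integral_by_parts s (a := 0) (b := Real.pi)
      (u := fun θ => Real.cos θ ^ k) (fun θ _ => (Real.hasDerivAt_cos θ).pow k) (by fun_prop)
    have hn := congrArg norm key
    rw [norm_mul, norm_mul, Complex.norm_I, Complex.norm_real, Real.norm_of_nonneg hs0.le,
      mul_one] at hn
    have e : s ^ (-(((1 : ℕ) + 1 : ℝ) / 2)) = 1 / s := by norm_num [Real.rpow_neg_one]
    rw [e, mul_one_div, le_div_iff₀ hs0, mul_comm]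
    simp only [pow_one]
    rw [hn]
    have h1 := norm_integral_mul_cosPhase_le s Real.pi_pos.le (M := k)
      (u := fun θ => k * Real.cos θ ^ (k - 1) * -Real.sin θ) (fun θ _ => by
        have := abs_cos_pow_mul_sin_pow_le (k - 1) 1 θ
        rw [show k * Real.cos θ ^ (k - 1) * -Real.sin θ =
          -(k * (Real.cos θ ^ (k - 1) * Real.sin θ ^ 1)) by ring, abs_neg, abs_mul,
          abs_of_nonneg (Nat.cast_nonneg k)]
        exact mul_le_of_le_one_right (by positivity) this)
    have h2 : ∀ θ, ‖((Real.cos θ ^ k : ℝ) : ℂ) * cosPhase s θ‖ ≤ 1 := fun θ => by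
      rw [norm_mul, norm_cosPhase, mul_one, Complex.norm_real]
      simpa using abs_cos_pow_mul_sin_pow_le k 0 θ
    refine (norm_sub_le _ _).trans ?_
    have h3 := norm_sub_le (((Real.cos Real.pi ^ k : ℝ) : ℂ) * cosPhase s Real.pi)
      (((Real.cos 0 ^ k : ℝ) : ℂ) * cosPhase s 0)
    have := h2 Real.pi
    have := h2 0
    rw [sub_zero] at h1
    linarith
  | more μ ih _ =>
    intro k
    obtain ⟨C₁, hC₁⟩ := ih (k - 1)
    obtain ⟨C₂, hC₂⟩ := ih (k + 1)
    refine ⟨k * C₁ + (k + (μ + 1)) * C₂, fun s hs => ?_⟩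
    have hs0 : 0 < s := by linarith
    have key := cosPhase_integral_by_parts s (a := 0) (b := Real.pi)
      (u := fun θ => Real.cos θ ^ k * Real.sin θ ^ (μ + 1))
      (fun θ _ => ((Real.hasDerivAt_cos θ).fun_pow k).mul
        ((Real.hasDerivAt_sin θ).fun_pow (μ + 1)))
      (by fun_prop)
    have hn := congrArg norm key
    rw [norm_mul, norm_mul, Complex.norm_I, Complex.norm_real, Real.norm_of_nonneg hs0.le,
      mul_one] at hn
    have e : s ^ (-(((μ + 2 : ℕ) + 1 : ℝ) / 2)) = s ^ (-((μ + 1 : ℝ) / 2)) / s := by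
      rw [← Real.rpow_sub_one hs0.ne']
      congr 1
      push_cast
      ring
    rw [e, mul_div_assoc', le_div_iff₀ hs0, mul_comm]
    have e2 : ∀ θ, Real.cos θ ^ k * Real.sin θ ^ (μ + 2) =
      Real.cos θ ^ k * Real.sin θ ^ (μ + 1) * Real.sin θ := fun θ => by ring
    simp only [e2]
    rw [hn]
    have e3 : ∀ θ, ((k * Real.cos θ ^ (k - 1) * -Real.sin θ * Real.sin θ ^ (μ + 1) +
        Real.cos θ ^ k * (((μ + 1 : ℕ) : ℝ) * Real.sin θ ^ (μ + 1 - 1) * Real.cos θ) : ℝ) : ℂ) *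
          cosPhase s θ =
        ((k + (μ + 1) : ℝ) : ℂ) *
          (((Real.cos θ ^ (k + 1) * Real.sin θ ^ μ : ℝ) : ℂ) * cosPhase s θ) -
        (k : ℝ) * (((Real.cos θ ^ (k - 1) * Real.sin θ ^ μ : ℝ) : ℂ) * cosPhase s θ) := by
      intro θ
      have hcs : Real.sin θ ^ 2 = 1 - Real.cos θ ^ 2 := Real.sin_sq θ
      rw [show (k * Real.cos θ ^ (k - 1) * -Real.sin θ * Real.sin θ ^ (μ + 1) +
          Real.cos θ ^ k * (((μ + 1 : ℕ) : ℝ) * Real.sin θ ^ (μ + 1 - 1) * Real.cos θ) : ℝ) =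
        (k + (μ + 1) : ℝ) * (Real.cos θ ^ (k + 1) * Real.sin θ ^ μ) -
          k * (Real.cos θ ^ (k - 1) * Real.sin θ ^ μ) by
        rcases k with _ | k
        · simp; ring
        · simp only [Nat.add_sub_cancel]
          push_cast
          rw [show (k + 1 : ℝ) * Real.cos θ ^ k * -Real.sin θ * Real.sin θ ^ (μ + 1) =
            -((k + 1 : ℝ) * Real.cos θ ^ k * Real.sin θ ^ μ * Real.sin θ ^ 2) by ring, hcs]
          ring]
      push_cast
      ring
    have hc : ∀ j : ℕ, IntervalIntegrable (fun θ =>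
        (((Real.cos θ ^ j * Real.sin θ ^ μ : ℝ) : ℂ) * cosPhase s θ)) volume 0 Real.pi :=
      fun j => Continuous.intervalIntegrable (by have := continuous_cosPhase s; fun_prop) _ _
    rw [intervalIntegral.integral_congr (fun θ _ => e3 θ), intervalIntegral.integral_sub
      ((hc _).const_mul _) ((hc _).const_mul _), intervalIntegral.integral_const_mul,
      intervalIntegral.integral_const_mul]
    simp only [Real.sin_pi, Real.sin_zero, ne_eq, Nat.succ_ne_zero, not_false_eq_true, zero_pow,
      mul_zero, Complex.ofReal_zero, zero_mul, sub_self, zero_sub, norm_neg]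
    refine (norm_sub_le _ _).trans ?_
    rw [norm_mul, norm_mul, Complex.norm_real, Complex.norm_real,
      Real.norm_of_nonneg (by positivity : (0 : ℝ) ≤ k + (μ + 1)),
      Real.norm_of_nonneg (by positivity : (0 : ℝ) ≤ k)]
    have := mul_le_mul_of_nonneg_left (hC₁ s hs) (by positivity : (0 : ℝ) ≤ k)
    have := mul_le_mul_of_nonneg_left (hC₂ s hs) (by positivity : (0 : ℝ) ≤ k + (μ + 1))
    linarith

lemma exists_norm_integral_prod_cosPhase_le {ι : Type*} (s : Finset ι) {M : ℝ} (hM : 0 ≤ M) :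
    ∀ k μ : ℕ, ∃ C : ℝ, 0 ≤ C ∧ ∀ a c : ι → ℝ, (∀ i ∈ s, |a i| ≤ M ∧ |c i| ≤ M) →
      ∀ r : ℝ, 1 ≤ r → ‖∫ θ in (0 : ℝ)..Real.pi, ((Real.cos θ ^ k * Real.sin θ ^ μ *
        ∏ i ∈ s, (a i * Real.cos θ + c i * Real.sin θ) : ℝ) : ℂ) * cosPhase r θ‖ ≤
        C * r ^ (-((μ + 1 : ℝ) / 2)) := by
  classical
  induction s using Finset.induction_on with
  | empty =>
    intro k μ
    obtain ⟨C, hC⟩ := exists_norm_integral_cos_sin_cosPhase_le μ k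
    refine ⟨C, ?_, fun a c _ r hr => by simpa using hC r hr⟩
    have := (norm_nonneg _).trans (hC 1 le_rfl)
    simpa using this
  | insert j s hj ih =>
    intro k μ
    obtain ⟨C₁, h₁0, h₁⟩ := ih (k + 1) μ
    obtain ⟨C₂, h₂0, h₂⟩ := ih k (μ + 1)
    refine ⟨M * C₁ + M * C₂, by positivity, fun a c hac r hr => ?_⟩
    have hac' : ∀ i ∈ s, |a i| ≤ M ∧ |c i| ≤ M := fun i hi => hac i (mem_insert_of_mem hi)
    have e : ∀ θ, ((Real.cos θ ^ k * Real.sin θ ^ μ *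
        ∏ i ∈ insert j s, (a i * Real.cos θ + c i * Real.sin θ) : ℝ) : ℂ) * cosPhase r θ =
        a j * (((Real.cos θ ^ (k + 1) * Real.sin θ ^ μ *
          ∏ i ∈ s, (a i * Real.cos θ + c i * Real.sin θ) : ℝ) : ℂ) * cosPhase r θ) +
        c j * (((Real.cos θ ^ k * Real.sin θ ^ (μ + 1) *
          ∏ i ∈ s, (a i * Real.cos θ + c i * Real.sin θ) : ℝ) : ℂ) * cosPhase r θ) := by
      intro θ
      rw [prod_insert hj]
      push_cast
      ring
    have hc : ∀ k μ : ℕ, IntervalIntegrable (fun θ => ((Real.cos θ ^ k * Real.sin θ ^ μ *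
          ∏ i ∈ s, (a i * Real.cos θ + c i * Real.sin θ) : ℝ) : ℂ) * cosPhase r θ)
          volume 0 Real.pi := fun k μ =>
      Continuous.intervalIntegrable (by have := continuous_cosPhase r; fun_prop) _ _
    rw [intervalIntegral.integral_congr fun θ _ => e θ, intervalIntegral.integral_add
      ((hc _ _).const_mul _) ((hc _ _).const_mul _), intervalIntegral.integral_const_mul,
      intervalIntegral.integral_const_mul]
    refine (norm_add_le _ _).trans ?_
    rw [norm_mul, norm_mul, Complex.norm_real, Complex.norm_real, add_mul, mul_assoc, mul_assoc]
    have hle : r ^ (-(((μ + 1 : ℕ) + 1 : ℝ) / 2)) ≤ r ^ (-((μ + 1 : ℝ) / 2)) :=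
      Real.rpow_le_rpow_of_exponent_le hr (by push_cast; linarith)
    have b₁ := h₁ a c hac' r hr
    have b₂ := (h₂ a c hac' r hr).trans (mul_le_mul_of_nonneg_left hle h₂0)
    obtain ⟨ha, hc'⟩ := hac j (mem_insert_self _ _)
    exact add_le_add (mul_le_mul ha b₁ (norm_nonneg _) hM) (mul_le_mul hc' b₂ (norm_nonneg _) hM)

/-- The point of `ℝ^(n+1)` with first coordinate `p.1` and remaining coordinates `p.2`. -/
noncomputable def euclideanCons (n : ℕ) (p : ℝ × EuclideanSpace ℝ (Fin n)) :
    EuclideanSpace ℝ (Fin (n + 1)) :=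
  WithLp.toLp 2 (Fin.cons p.1 (WithLp.ofLp p.2) : Fin (n + 1) → ℝ)

lemma measurePreserving_euclideanCons (n : ℕ) :
    MeasurePreserving (euclideanCons n) volume volume := by
  have h1 : MeasurePreserving
      (Prod.map id (MeasurableEquiv.toLp 2 (Fin n → ℝ)).symm :
        ℝ × EuclideanSpace ℝ (Fin n) → ℝ × (Fin n → ℝ)) volume volume :=
    (MeasurePreserving.id volume).prod
      (EuclideanSpace.volume_preserving_symm_measurableEquiv_toLp (Fin n))
  have h2 := (volume_preserving_piFinSuccAbove (fun _ : Fin (n + 1) => ℝ) 0).symm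
  have h3 := (EuclideanSpace.volume_preserving_symm_measurableEquiv_toLp (Fin (n + 1))).symm
  have h4 : euclideanCons n = (MeasurableEquiv.toLp 2 (Fin (n + 1) → ℝ)) ∘
      (MeasurableEquiv.piFinSuccAbove (fun _ : Fin (n + 1) => ℝ) 0).symm ∘
      Prod.map id (MeasurableEquiv.toLp 2 (Fin n → ℝ)).symm := by
    funext p
    ext i
    refine Fin.cases ?_ (fun j => ?_) i <;>
      simp [euclideanCons, MeasurableEquiv.piFinSuccAbove, Fin.insertNthEquiv]
  rw [h4]
  exact h3.comp (h2.comp h1)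

lemma norm_sq_euclideanCons (n : ℕ) (p : ℝ × EuclideanSpace ℝ (Fin n)) :
    ‖euclideanCons n p‖ ^ 2 = p.1 ^ 2 + ‖p.2‖ ^ 2 := by
  simp [EuclideanSpace.norm_sq_eq, euclideanCons, Fin.sum_univ_succ]

lemma inner_euclideanCons (n : ℕ) (w : EuclideanSpace ℝ (Fin (n + 1)))
    (p : ℝ × EuclideanSpace ℝ (Fin n)) :
    inner ℝ w (euclideanCons n p) =
      w 0 * p.1 + inner ℝ (WithLp.toLp 2 fun i => w (Fin.succ i)) p.2 := by
  simp [PiLp.inner_apply, euclideanCons, Fin.sum_univ_succ, mul_comm]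

lemma norm_tail_le (n : ℕ) (w : EuclideanSpace ℝ (Fin (n + 1))) :
    ‖(WithLp.toLp 2 fun i => w (Fin.succ i) : EuclideanSpace ℝ (Fin n))‖ ≤ ‖w‖ := by
  refine (sq_le_sq₀ (norm_nonneg _) (norm_nonneg _)).1 ?_
  simp only [EuclideanSpace.norm_sq_eq, Fin.sum_univ_succ (n := n)]
  nlinarith [sq_nonneg ‖w 0‖]

lemma injective_euclideanCons (n : ℕ) : Function.Injective (euclideanCons n) := by
  intro p q h
  have h' := congrArg WithLp.ofLp h
  simp only [euclideanCons] at h'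
  have := Fin.cons_injective2 h'
  exact Prod.ext this.1 (by ext i; exact congrFun this.2 i)

lemma continuous_euclideanCons (n : ℕ) : Continuous (euclideanCons n) := by
  unfold euclideanCons
  refine (PiLp.continuous_toLp 2 _).comp (continuous_pi fun i => ?_)
  refine Fin.cases ?_ (fun j => ?_) i
  · simpa using continuous_fst
  · simp only [Fin.cons_succ]; fun_prop

lemma measurableEmbedding_euclideanCons (n : ℕ) : MeasurableEmbedding (euclideanCons n) :=
  (continuous_euclideanCons n).measurableEmbedding (injective_euclideanCons n)

lemma setIntegral_slice_closedBall (n : ℕ) {F : EuclideanSpace ℝ (Fin (n + 1)) → ℂ}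
    {θ : ℝ} (hθ : θ ∈ Set.Ioo 0 Real.pi) :
    ∫ y, (Metric.closedBall 0 1).indicator F (euclideanCons n (Real.cos θ, y)) =
      Real.sin θ ^ n • ∫ z in Metric.closedBall (0 : EuclideanSpace ℝ (Fin n)) 1,
        F (euclideanCons n (Real.cos θ, Real.sin θ • z)) := by
  have hs : 0 < Real.sin θ := Real.sin_pos_of_mem_Ioo hθ
  rw [Measure.setIntegral_comp_smul_of_pos (f := fun y => F (euclideanCons n (Real.cos θ, y)))
    volume _ hs, finrank_euclideanSpace_fin, smul_smul, mul_inv_cancel₀ (pow_ne_zero _ hs.ne'),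
    one_smul, smul_closedBall _ _ zero_le_one, smul_zero, mul_one, Real.norm_of_nonneg hs.le,
    ← integral_indicator Metric.isClosed_closedBall.measurableSet]
  congr 1
  funext y
  have h : ‖euclideanCons n (Real.cos θ, y)‖ ≤ 1 ↔ ‖y‖ ≤ Real.sin θ := by
    rw [← sq_le_sq₀ (norm_nonneg _) zero_le_one, norm_sq_euclideanCons,
      ← sq_le_sq₀ (norm_nonneg y) hs.le, Real.sin_sq]
    constructor <;> intro h <;> simp only at * <;> linarith
  by_cases hy : ‖y‖ ≤ Real.sin θ
  · rw [Set.indicator_of_mem (mem_closedBall_zero_iff.2 (h.2 hy)),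
      Set.indicator_of_mem (mem_closedBall_zero_iff.2 hy)]
  · rw [Set.indicator_of_notMem (mt mem_closedBall_zero_iff.1 (mt h.1 hy)),
      Set.indicator_of_notMem (mt mem_closedBall_zero_iff.1 hy)]

lemma setIntegral_closedBall_eq (n : ℕ) {F : EuclideanSpace ℝ (Fin (n + 1)) → ℂ}
    (hF : Continuous F) :
    ∫ x in Metric.closedBall 0 1, F x =
      ∫ z in Metric.closedBall (0 : EuclideanSpace ℝ (Fin n)) 1, ∫ θ in (0 : ℝ)..Real.pi,
        (Real.sin θ ^ (n + 1) : ℝ) • F (euclideanCons n (Real.cos θ, Real.sin θ • z)) := by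
  have hint : Integrable ((Metric.closedBall 0 1).indicator F) :=
    (integrable_indicator_iff Metric.isClosed_closedBall.measurableSet).2
      (hF.continuousOn.integrableOn_compact (isCompact_closedBall _ _))
  have hint' : Integrable (fun p => (Metric.closedBall 0 1).indicator F (euclideanCons n p)) :=
    ((measurePreserving_euclideanCons n).integrable_comp_emb
      (measurableEmbedding_euclideanCons n)).2 hint
  rw [← integral_indicator Metric.isClosed_closedBall.measurableSet,
    ← (measurePreserving_euclideanCons n).integral_comp (measurableEmbedding_euclideanCons n),
    Measure.volume_eq_prod, integral_prod _ hint']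
  set G : ℝ → ℂ := fun t => ∫ y, (Metric.closedBall 0 1).indicator F (euclideanCons n (t, y))
  have h0 : ∀ t ∉ Set.Icc (-1 : ℝ) 1, G t = 0 := by
    intro t ht
    simp only [G]
    refine integral_eq_zero_of_ae (ae_of_all _ fun y => ?_)
    refine Set.indicator_of_notMem (fun hy => ht ?_) _
    rw [mem_closedBall_zero_iff, ← sq_le_sq₀ (norm_nonneg _) zero_le_one,
      norm_sq_euclideanCons] at hy
    rw [Set.mem_Icc, ← abs_le, ← sq_le_one_iff_abs_le_one]
    simp only at hy
    nlinarith [sq_nonneg ‖y‖]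
  rw [← setIntegral_eq_integral_of_forall_compl_eq_zero h0, ← Real.bijOn_cos.image_eq,
    integral_image_eq_integral_abs_deriv_smul measurableSet_Icc
      (fun θ _ => (Real.hasDerivAt_cos θ).hasDerivWithinAt) Real.bijOn_cos.injOn,
    integral_Icc_eq_integral_Ioo]
  have h1 : ∀ θ ∈ Set.Ioo 0 Real.pi, |-Real.sin θ| • G (Real.cos θ) =
      ∫ z in Metric.closedBall (0 : EuclideanSpace ℝ (Fin n)) 1,
        (Real.sin θ ^ (n + 1) : ℝ) • F (euclideanCons n (Real.cos θ, Real.sin θ • z)) := by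
    intro θ hθ
    have hs : 0 < Real.sin θ := Real.sin_pos_of_mem_Ioo hθ
    rw [abs_neg, abs_of_pos hs, integral_smul, pow_succ', ← smul_smul,
      ← setIntegral_slice_closedBall n hθ]
  rw [setIntegral_congr_fun measurableSet_Ioo h1, ← integral_Icc_eq_integral_Ioo]
  simp only [intervalIntegral.integral_of_le Real.pi_pos.le, ← integral_Icc_eq_integral_Ioc]
  rw [integral_integral_swap]
  have := continuous_euclideanCons n
  rw [Measure.prod_restrict]
  refine Continuous.continuousOn ?_ |>.integrableOn_compact
    (isCompact_Icc.prod (isCompact_closedBall _ _))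
  simp only [Function.uncurry_def]
  fun_prop

lemma exists_norm_fourier_closedBall_le {ι : Type*} (n : ℕ) (s : Finset ι)
    (v : ι → EuclideanSpace ℝ (Fin (n + 1))) :
    ∃ C : ℝ, 0 ≤ C ∧ ∀ η : EuclideanSpace ℝ (Fin (n + 1)), 1 ≤ ‖η‖ →
      ‖∫ x in Metric.closedBall 0 1, ((∏ i ∈ s, inner ℝ (v i) x : ℝ) : ℂ) *
        Complex.exp (-(inner ℝ η x : ℝ) * Complex.I)‖ ≤
        C * ‖η‖ ^ (-((n + 2 : ℝ) / 2)) := by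
  obtain ⟨C, hC0, hC⟩ := exists_norm_integral_prod_cosPhase_le s
    (M := ∑ i ∈ s, ‖v i‖) (by positivity) 0 (n + 1)
  refine ⟨C * volume.real (Metric.closedBall (0 : EuclideanSpace ℝ (Fin n)) 1), by positivity,
    fun η hη => ?_⟩
  have hη0 : ‖η‖ ≠ 0 := by positivity
  obtain ⟨b, hb⟩ := Orthonormal.exists_orthonormalBasis_extension_of_card_eq (𝕜 := ℝ)
    (E := EuclideanSpace ℝ (Fin (n + 1))) (ι := Fin (n + 1)) (by simp)
    (v := fun _ => ‖η‖⁻¹ • η) (s := {0}) (by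
      rw [orthonormal_iff_ite]
      rintro ⟨i, hi⟩ ⟨j, hj⟩
      rw [Set.mem_singleton_iff] at hi hj
      subst hi hj
      simp [Set.domRestrict, norm_smul, hη0])
  have hb0 : b 0 = ‖η‖⁻¹ • η := hb 0 rfl
  have hηb : ∀ x, inner ℝ η (b.repr.symm x) = ‖η‖ * x 0 := by
    intro x
    have : η = ‖η‖ • b 0 := by rw [hb0, smul_smul, mul_inv_cancel₀ hη0, one_smul]
    conv_lhs => rw [this]
    rw [real_inner_smul_left, ← b.repr_apply_apply, LinearIsometryEquiv.apply_symm_apply]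
  have hvb : ∀ i x, inner ℝ (v i) (b.repr.symm x) = inner ℝ (b.repr (v i)) x := fun i x => by
    rw [← b.repr.inner_map_map, LinearIsometryEquiv.apply_symm_apply]
  set F : EuclideanSpace ℝ (Fin (n + 1)) → ℂ := fun x =>
    ((∏ i ∈ s, inner ℝ (b.repr (v i)) x : ℝ) : ℂ) *
        Complex.exp (-(‖η‖ * x 0 : ℝ) * Complex.I) with hF
  have hFc : Continuous F := by
    simp only [hF]
    fun_prop
  have hrot : ∫ x in Metric.closedBall 0 1, ((∏ i ∈ s, inner ℝ (v i) x : ℝ) : ℂ) *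
        Complex.exp (-(inner ℝ η x : ℝ) * Complex.I) = ∫ x in Metric.closedBall 0 1, F x := by
    rw [← b.measurePreserving_repr_symm.setIntegral_preimage_emb
      b.repr.symm.toHomeomorph.measurableEmbedding, LinearIsometryEquiv.preimage_closedBall]
    simp [hηb, hvb, hF]
  rw [hrot, setIntegral_closedBall_eq n hFc, mul_right_comm]
  refine norm_setIntegral_le_of_norm_le_const measure_closedBall_lt_top fun z hz => ?_
  rw [mem_closedBall_zero_iff] at hz
  have key := hC (fun i => b.repr (v i) 0) (fun i =>
    inner ℝ (WithLp.toLp 2 fun j => b.repr (v i) (Fin.succ j)) z) (fun i hi => by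
      have h1 : ‖v i‖ ≤ ∑ i ∈ s, ‖v i‖ := single_le_sum (fun _ _ => norm_nonneg _) hi
      constructor
      · refine le_trans ?_ h1
        rw [← b.repr.norm_map]
        exact PiLp.norm_apply_le (b.repr (v i)) 0
      · refine (abs_real_inner_le_norm _ _).trans (le_trans ?_ h1)
        rw [← b.repr.norm_map (v i)]
        refine (mul_le_of_le_one_right (norm_nonneg _) hz).trans ?_
        exact norm_tail_le n (b.repr (v i))) ‖η‖ hη
  have e : -(((n + 1 : ℕ) + 1 : ℝ) / 2) = -((n + 2 : ℝ) / 2) := by push_cast; ring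
  rw [e] at key
  refine le_of_eq_of_le ?_ key
  congr 1
  refine intervalIntegral.integral_congr fun θ _ => ?_
  simp only [hF, inner_euclideanCons, real_inner_smul_right, cosPhase, Complex.real_smul]
  have : (euclideanCons n (Real.cos θ, Real.sin θ • z)) 0 = Real.cos θ := by
    simp [euclideanCons]
  rw [this, pow_zero, one_mul, Complex.ofReal_mul (Real.sin θ ^ (n + 1)), mul_assoc]
  simp only [mul_comm (Real.sin θ)]

lemma summable_norm_prod_and_hasSum_prod {𝕜 : Type*} [NormedField 𝕜] [CompleteSpace 𝕜]
    {α : Type*} (N : ℕ) (f : Fin N → α → 𝕜) (hf : ∀ i, Summable fun k => ‖f i k‖) :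
    (Summable fun ξ : Fin N → α => ‖∏ i, f i (ξ i)‖) ∧
      HasSum (fun ξ : Fin N → α => ∏ i, f i (ξ i)) (∏ i, ∑' k, f i k) := by
  induction N with
  | zero =>
    refine ⟨(hasSum_unique _).summable, ?_⟩
    convert hasSum_unique _ using 1
    · simp
    · infer_instance
  | succ N ih =>
    obtain ⟨g, hg⟩ : ∃ g : (Fin N → α) → 𝕜, g = fun q => ∏ i, f i.succ (q i) := ⟨_, rfl⟩
    obtain ⟨h1, h2⟩ := ih (fun i => f i.succ) fun i => hf i.succ
    simp only [← congrFun hg] at h1 h2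
    have he : ∀ p : α × (Fin N → α),
        ∏ i, f i (Fin.consEquiv (fun _ : Fin (N + 1) => α) p i) = f 0 p.1 * g p.2 := fun p => by
      rw [Fin.prod_univ_succ, hg]; rfl
    have hs : Summable fun p : α × (Fin N → α) => ‖f 0 p.1 * g p.2‖ :=
      Summable.mul_norm (hf 0) h1
    constructor
    · rw [← (Fin.consEquiv fun _ : Fin (N + 1) => α).summable_iff]
      simpa only [Function.comp_def, he] using hs
    · rw [← (Fin.consEquiv fun _ : Fin (N + 1) => α).hasSum_iff, Fin.prod_univ_succ]
      simp only [Function.comp_def, he]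
      rw [← h2.tsum_eq, tsum_mul_tsum_of_summable_norm (hf 0) h1]
      exact hs.of_norm.hasSum

lemma rpow_mul_rpow_le_sub {β δ : ℝ} (hβ0 : 0 < β) (hβ1 : β < 1) (hδ : 0 < δ) (k : ℕ) :
    (1 - β) * ((1 + ((k + 1 : ℕ) : ℝ)) ^ (-β) * ((1 + δ * ((k + 1 : ℕ) : ℝ)) ^ 2)⁻¹) ≤
      (((k + 1 : ℕ) : ℝ) / (1 + δ * ((k + 1 : ℕ) : ℝ))) ^ (1 - β) -
        ((k : ℝ) / (1 + δ * k)) ^ (1 - β) := by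
  have hpos : ∀ x : ℝ, 0 ≤ x → 0 < 1 + δ * x := fun x hx => by positivity
  have hk : (k : ℝ) < ((k + 1 : ℕ) : ℝ) := by push_cast; linarith
  have hk0 : (0 : ℝ) ≤ k := Nat.cast_nonneg k
  have hd : ∀ x ∈ Set.Ioo (k : ℝ) ((k + 1 : ℕ) : ℝ),
      HasDerivAt (fun x => (x / (1 + δ * x)) ^ (1 - β))
        ((1 - β) * (x ^ (-β) * ((1 + δ * x) ^ (2 - β))⁻¹)) x := by
    intro x hx
    have hx0 : 0 < x := hk0.trans_lt hx.1
    have hp := hpos x hx0.le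
    have h1 : HasDerivAt (fun x => x / (1 + δ * x)) (((1 : ℝ) * (1 + δ * x) - x * (δ * 1)) /
        (1 + δ * x) ^ 2) x :=
      (hasDerivAt_id x).div (((hasDerivAt_id x).const_mul δ).const_add 1) hp.ne'
    refine (h1.rpow_const (p := 1 - β) (Or.inl (div_pos hx0 hp).ne')).congr_deriv ?_
    rw [show 1 - β - 1 = -β by ring, Real.div_rpow hx0.le hp.le, Real.rpow_neg hp.le,
      Real.rpow_sub hp, Real.rpow_two]
    have := (Real.rpow_pos_of_pos hp β).ne'
    field_simp
    ring
  have hc : ContinuousOn (fun x : ℝ => (x / (1 + δ * x)) ^ (1 - β))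
      (Set.Icc (k : ℝ) ((k + 1 : ℕ) : ℝ)) := by
    refine ContinuousOn.rpow_const (ContinuousOn.div (by fun_prop) (by fun_prop) fun x hx =>
      (hpos x (hk0.trans hx.1)).ne') fun x _ => Or.inr (by linarith)
  obtain ⟨c, hcm, hc'⟩ := exists_hasDerivAt_eq_slope _ _ hk hc hd
  rw [show ((k + 1 : ℕ) : ℝ) - k = 1 by push_cast; ring, div_one] at hc'
  rw [← hc']
  have hc0 : 0 < c := hk0.trans_lt hcm.1
  have hp := hpos c hc0.le
  have h1β : 0 ≤ 1 - β := by linarith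
  refine mul_le_mul_of_nonneg_left ?_ h1β
  refine mul_le_mul ?_ ?_ (by positivity) (by positivity)
  · exact Real.rpow_le_rpow_of_nonpos hc0 (by linarith [hcm.2]) (by linarith)
  · refine inv_anti₀ (by positivity) ?_
    rw [← Real.rpow_two]
    calc (1 + δ * c) ^ (2 - β) ≤ (1 + δ * c) ^ (2 : ℝ) :=
          Real.rpow_le_rpow_of_exponent_le (by nlinarith) (by linarith)
      _ ≤ _ := by
        refine Real.rpow_le_rpow hp.le ?_ (by norm_num)
        have := hcm.2.le
        gcongr

/-- The model weight bounding the mollified Fourier coefficients in one variable. -/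
noncomputable def latticeWeight (β δ : ℝ) (k : ℤ) : ℝ :=
  (1 + |(k : ℝ)|) ^ (-β) * ((1 + δ * |(k : ℝ)|) ^ 2)⁻¹

lemma latticeWeight_nonneg (β δ : ℝ) (k : ℤ) : 0 ≤ latticeWeight β δ k := by
  unfold latticeWeight; positivity

lemma summable_latticeWeight_and_tsum_le {β δ : ℝ} (hβ0 : 0 < β) (hβ1 : β < 1) (hδ : 0 < δ)
    (hδ1 : δ ≤ 1) :
    Summable (latticeWeight β δ) ∧
      ∑' k, latticeWeight β δ k ≤ (1 + 2 / (1 - β)) * δ ^ (β - 1) := by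
  have h1β : 0 < 1 - β := by linarith
  set g : ℕ → ℝ := fun k => ((k : ℝ) / (1 + δ * k)) ^ (1 - β)
  have hg : ∀ k, g k ≤ δ ^ (β - 1) := by
    intro k
    simp only [g]
    rw [show β - 1 = -(1 - β) by ring, Real.rpow_neg hδ.le, ← Real.inv_rpow hδ.le]
    refine Real.rpow_le_rpow (by positivity) ?_ h1β.le
    rw [div_le_iff₀ (by positivity), mul_add, inv_mul_cancel_left₀ hδ.ne']
    have : 0 < δ⁻¹ := by positivity
    linarith
  have hg0 : g 0 = 0 := by simp [g, h1β.ne']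
  have hpart : ∀ n, ∑ k ∈ range n, latticeWeight β δ ((k + 1 : ℕ) : ℤ) ≤
      δ ^ (β - 1) / (1 - β) := by
    intro n
    rw [le_div_iff₀' h1β, mul_sum]
    refine le_trans (sum_le_sum fun k _ => ?_) (((sum_range_sub g n).le).trans (by
      rw [hg0, sub_zero]; exact hg n))
    have := rpow_mul_rpow_le_sub hβ0 hβ1 hδ k
    simpa only [latticeWeight, Int.cast_natCast, Nat.abs_cast] using this
  have hnn : ∀ k : ℕ, 0 ≤ latticeWeight β δ ((k + 1 : ℕ) : ℤ) := fun k => latticeWeight_nonneg _ _ _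
  have hs1 : Summable fun k : ℕ => latticeWeight β δ ((k + 1 : ℕ) : ℤ) :=
    summable_of_sum_range_le hnn hpart
  have ht1 := Real.tsum_le_of_sum_range_le hnn hpart
  have hneg : ∀ k, latticeWeight β δ (-k) = latticeWeight β δ k := fun k => by
    simp [latticeWeight]
  have hs2 : Summable fun k : ℕ => latticeWeight β δ (-(k + 1 : ℤ)) := by
    simp only [hneg]; exact_mod_cast hs1
  have hsum := HasSum.of_add_one_of_neg_add_one (f := latticeWeight β δ)
    (by exact_mod_cast hs1.hasSum) hs2.hasSum
  refine ⟨hsum.summable, ?_⟩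
  rw [hsum.tsum_eq]
  have e2 : ∑' k : ℕ, latticeWeight β δ (-(k + 1 : ℤ)) =
      ∑' k : ℕ, latticeWeight β δ ((k + 1 : ℕ) : ℤ) := by
    refine tsum_congr fun k => ?_
    rw [hneg]; push_cast; rfl
  have e0 : latticeWeight β δ 0 = 1 := by simp [latticeWeight]
  have h1 : 1 ≤ δ ^ (β - 1) := Real.one_le_rpow_of_pos_of_le_one_of_nonpos hδ hδ1 (by linarith)
  rw [e2, e0]
  calc _ ≤ δ ^ (β - 1) / (1 - β) + δ ^ (β - 1) + δ ^ (β - 1) / (1 - β) := by gcongr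
    _ = _ := by field_simp; ring

lemma abs_sum_integral_mollified_sub_integral_le {N : ℕ} {φ : ℝ → ℝ} {c : ℝ → ℂ} {A r : ℝ}
    (hφr : ∀ x, r < |x| → φ x = 0) (hc0 : c 0 = 1) (hA : 0 ≤ A)
    (hcA : ∀ η, ‖c η‖ ≤ A * ((1 + |η|) ^ 2)⁻¹) {δ : ℝ} (hδ : 0 < δ) (hδ1 : δ ≤ 1)
    (hP : ∀ x : ℝ, ∑' n : ℤ, ((δ⁻¹ * φ ((x + n) / δ) : ℝ) : ℂ) =
        ∑' n : ℤ, c (δ * n) * Complex.exp (2 * Real.pi * Complex.I * n * x))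
    (ρ : Fin N → ℝ) {S : Set (EuclideanSpace ℝ (Fin N))} (hS : MeasurableSet S)
    {f : EuclideanSpace ℝ (Fin N) → ℝ} (hf : IntegrableOn f S)
    (T : Finset (Fin N → ℤ))
    (hT : ∀ b ∉ T, ∀ x ∈ S, ∏ i, (δ⁻¹ * φ ((ρ i - x i + b i) / δ)) = 0)
    (hint : ∀ b ∈ T, IntegrableOn (fun x => f x * ∏ i, (δ⁻¹ * φ ((ρ i - x i + b i) / δ))) S)
    {K β : ℝ} (hβ0 : 0 < β) (hβ1 : β < 1) (hK0 : 0 ≤ K)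
    (hK : ∀ ξ : Fin N → ℤ, ξ ≠ 0 →
      ‖∫ x in S, (f x : ℂ) * Complex.exp (-(∑ i, 2 * Real.pi * ξ i * x i : ℝ) * Complex.I)‖ ≤
        K * ∏ i, (1 + |(ξ i : ℝ)|) ^ (-β)) :
    |∑ b ∈ T, (∫ x in S, f x * ∏ i, (δ⁻¹ * φ ((ρ i - x i + b i) / δ))) - ∫ x in S, f x| ≤
      K * A ^ N * ((1 + 2 / (1 - β)) * δ ^ (β - 1)) ^ N := by
  obtain ⟨hw, hwle⟩ := summable_latticeWeight_and_tsum_le hβ0 hβ1 hδ hδ1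
  have hcw : ∀ k : ℤ, ‖c (δ * k)‖ * (1 + |(k : ℝ)|) ^ (-β) ≤ A * latticeWeight β δ k := by
    intro k
    have := hcA (δ * k)
    rw [abs_mul, abs_of_pos hδ] at this
    calc _ ≤ A * ((1 + δ * |(k : ℝ)|) ^ 2)⁻¹ * (1 + |(k : ℝ)|) ^ (-β) := by gcongr
      _ = _ := by rw [latticeWeight]; ring
  have hcs : Summable fun k : ℤ => ‖c (δ * k)‖ := by
    have h := (Real.summable_one_div_int_pow.mpr one_lt_two).mul_left (A * (δ ^ 2)⁻¹)
    refine h.of_norm_bounded_eventually ?_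
    filter_upwards [(Set.finite_singleton (0 : ℤ)).compl_mem_cofinite] with k hk
    have hk0 : (k : ℝ) ≠ 0 := by exact_mod_cast hk
    have hk1 : 0 < |(k : ℝ)| := abs_pos.mpr hk0
    rw [norm_norm]
    refine (hcA _).trans ?_
    rw [mul_assoc, one_div, ← mul_inv, abs_mul, abs_of_pos hδ, ← sq_abs (k : ℝ), ← mul_pow]
    gcongr
    linarith
  have hexp : ∀ (k : ℤ) (y : ℝ), ‖Complex.exp (2 * Real.pi * Complex.I * k * y)‖ = 1 := by
    intro k y
    rw [show (2 * Real.pi * Complex.I * k * y : ℂ) = ((2 * Real.pi * k * y : ℝ) : ℂ) * Complex.I by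
      push_cast; ring]
    exact Complex.norm_exp_ofReal_mul_I _
  obtain ⟨a, ha⟩ : ∃ a : (Fin N → ℤ) → EuclideanSpace ℝ (Fin N) → ℂ, a = fun ξ x =>
    ∏ i, (c (δ * ξ i) * Complex.exp (2 * Real.pi * Complex.I * ξ i * (ρ i - x i : ℝ))) := ⟨_, rfl⟩
  have hanorm : ∀ ξ x, ‖a ξ x‖ = ∏ i, ‖c (δ * ξ i)‖ := by
    intro ξ x
    simp only [ha, norm_prod, norm_mul, hexp, mul_one]
  have hcprod : Summable fun ξ : Fin N → ℤ => ∏ i, ‖c (δ * ξ i)‖ := by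
    simpa [norm_prod] using (summable_norm_prod_and_hasSum_prod N
      (fun (_ : Fin N) (k : ℤ) => c (δ * k)) fun _ => hcs).1
  have hpoint : ∀ x ∈ S, ∑ b ∈ T, ((∏ i, (δ⁻¹ * φ ((ρ i - x i + b i) / δ)) : ℝ) : ℂ) =
      ∑' ξ, a ξ x := by
    intro x hx
    rw [← tsum_eq_sum (L := SummationFilter.unconditional _) (f := fun b : Fin N → ℤ =>
      ((∏ i, (δ⁻¹ * φ ((ρ i - x i + b i) / δ)) : ℝ) : ℂ)) (fun b hb => by
        rw [hT b hb x hx, Complex.ofReal_zero])]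
    have h1 := (summable_norm_prod_and_hasSum_prod N (fun (i : Fin N) (k : ℤ) =>
      ((δ⁻¹ * φ ((ρ i - x i + k) / δ) : ℝ) : ℂ)) fun i => by
        have hfin : {k : ℤ | ρ i - x i + k ∈ Set.Icc (-(r * δ)) (r * δ)}.Finite := by
          refine (Set.finite_Icc ⌊-(r * δ) - (ρ i - x i)⌋ ⌈r * δ - (ρ i - x i)⌉).subset
            fun k hk => ⟨?_, ?_⟩
          · exact_mod_cast (Int.floor_le _).trans (by linarith [hk.1] : _ ≤ (k : ℝ))
          · exact_mod_cast (by linarith [hk.2] : (k : ℝ) ≤ _).trans (Int.le_ceil _)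
        refine summable_of_hasFiniteSupport (hfin.subset fun k hk => ?_)
        by_contra hk'
        refine hk ?_
        dsimp only
        rw [hφr, mul_zero, Complex.ofReal_zero, norm_zero]
        rw [abs_div, abs_of_pos hδ, lt_div_iff₀ hδ]
        by_contra! hle
        exact hk' (abs_le.mp hle)).2.tsum_eq
    have h2 := (summable_norm_prod_and_hasSum_prod N (fun (i : Fin N) (k : ℤ) =>
      (c (δ * k) * Complex.exp (2 * Real.pi * Complex.I * k * (ρ i - x i : ℝ)))) fun i => by
        simpa only [norm_mul, hexp, mul_one] using hcs).2.tsum_eq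
    simp only [Complex.ofReal_prod]
    rw [h1, ha]
    rw [h2]
    exact prod_congr rfl fun i _ => hP _
  have hamul : ∀ ξ x, (f x : ℂ) * a ξ x = ((∏ i, c (δ * ξ i)) *
      Complex.exp ((∑ i, 2 * Real.pi * ξ i * ρ i : ℝ) * Complex.I)) * ((f x : ℂ) *
        Complex.exp (-(∑ i, 2 * Real.pi * ξ i * x i : ℝ) * Complex.I)) := by
    intro ξ x
    have h : a ξ x = (∏ i, c (δ * ξ i)) *
      (Complex.exp ((∑ i, 2 * Real.pi * ξ i * ρ i : ℝ) * Complex.I) *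
        Complex.exp (-(∑ i, 2 * Real.pi * ξ i * x i : ℝ) * Complex.I)) := by
      rw [ha]
      simp only [prod_mul_distrib]
      rw [← Complex.exp_sum, ← Complex.exp_add]
      congr 2
      push_cast
      rw [← add_mul, ← sub_eq_add_neg, ← sum_sub_distrib, sum_mul]
      exact sum_congr rfl fun i _ => by ring
    rw [h]; ring
  have hain : ∀ ξ, IntegrableOn (fun x => (f x : ℂ) * a ξ x) S := by
    intro ξ
    have hac : Continuous (a ξ) := by rw [ha]; fun_prop
    refine (Integrable.bdd_mul (c := ∏ i, ‖c (δ * ξ i)‖) (Integrable.ofReal hf)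
      hac.aestronglyMeasurable (ae_of_all _ fun x => (hanorm ξ x).le)).congr
      (ae_of_all _ fun x => mul_comm _ _)
  have hsumm : Summable fun ξ => ∫ x in S, ‖(f x : ℂ) * a ξ x‖ := by
    refine (hcprod.mul_left (∫ x in S, |f x|)).congr fun ξ => ?_
    simp only [norm_mul, hanorm, integral_mul_const, Complex.norm_real, Real.norm_eq_abs]
  have hswap := hasSum_integral_of_summable_integral_norm (μ := volume.restrict S) hain hsumm
  have hmain : ((∑ b ∈ T, (∫ x in S, f x * ∏ i, (δ⁻¹ * φ ((ρ i - x i + b i) / δ))) : ℝ) : ℂ) =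
      ∫ x in S, ∑' ξ, (f x : ℂ) * a ξ x := by
    rw [← integral_finsetSum _ hint, ← integral_complex_ofReal]
    refine setIntegral_congr_fun hS fun x hx => ?_
    simp only [tsum_mul_left]
    rw [← hpoint x hx, ← mul_sum]
    push_cast
    rfl
  rw [← hmain] at hswap
  have ha0 : ∀ x, a 0 x = 1 := fun x => by simp [ha, hc0]
  have hsub := hswap.sub (hasSum_ite_eq (0 : Fin N → ℤ) (((∫ x in S, f x : ℝ) : ℂ)))
  rw [← Real.norm_eq_abs, ← Complex.norm_real, Complex.ofReal_sub, ← hsub.tsum_eq]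
  have hprodw := summable_norm_prod_and_hasSum_prod N
    (fun (_ : Fin N) (k : ℤ) => A * latticeWeight β δ k) fun _ => (hw.mul_left A).norm
  have hbound := hprodw.2.mul_left K
  have hle := tsum_of_norm_bounded (f := fun ξ => (∫ x in S, (f x : ℂ) * a ξ x) -
    if ξ = 0 then ((∫ x in S, f x : ℝ) : ℂ) else 0) hbound fun ξ => by
      have hnn : 0 ≤ K * ∏ i, A * latticeWeight β δ (ξ i) :=
        mul_nonneg hK0 (prod_nonneg fun i _ => mul_nonneg hA (latticeWeight_nonneg _ _ _))
      by_cases hξ : ξ = 0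
      · subst hξ
        simp only [ha0, mul_one, if_true, integral_complex_ofReal, sub_self, norm_zero]
        exact hnn
      · rw [if_neg hξ, sub_zero]
        simp only [hamul]
        rw [integral_const_mul, norm_mul, norm_mul, Complex.norm_exp_ofReal_mul_I, mul_one,
          norm_prod]
        calc _ ≤ (∏ i, ‖c (δ * ξ i)‖) * (K * ∏ i, (1 + |(ξ i : ℝ)|) ^ (-β)) := by
              gcongr; exact hK ξ hξ
          _ = K * ∏ i, (‖c (δ * ξ i)‖ * (1 + |(ξ i : ℝ)|) ^ (-β)) := by
              rw [prod_mul_distrib]; ring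
          _ ≤ _ := by
              exact mul_le_mul_of_nonneg_left (prod_le_prod (fun i _ => by positivity)
                fun i _ => hcw _) hK0
  refine hle.trans ?_
  rw [prod_const, card_univ, Fintype.card_fin, tsum_mul_left, mul_pow, mul_assoc]
  gcongr
  exact tsum_nonneg fun k => latticeWeight_nonneg _ _ _

open FourierTransform in
lemma exists_poisson_kernel {r : ℝ} (hr : 0 < r) :
    ∃ (φ : ℝ → ℝ) (c : ℝ → ℂ) (A : ℝ), Continuous φ ∧ (∀ x, 0 ≤ φ x) ∧
      (∀ x, r < |x| → φ x = 0) ∧ ∫ x, φ x = 1 ∧ c 0 = 1 ∧ 0 ≤ A ∧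
      (∀ η, ‖c η‖ ≤ A * ((1 + |η|) ^ 2)⁻¹) ∧
      ∀ δ : ℝ, 0 < δ → ∀ x : ℝ, ∑' n : ℤ, ((δ⁻¹ * φ ((x + n) / δ) : ℝ) : ℂ) =
        ∑' n : ℤ, c (δ * n) * Complex.exp (2 * Real.pi * Complex.I * n * x) := by
  let f : ContDiffBump (0 : ℝ) := ⟨r / 2, r, by linarith, by linarith⟩
  let φ := f.normed volume
  have hφc : ContDiff ℝ (⊤ : ℕ∞) φ := f.contDiff_normed
  have hφs : HasCompactSupport φ := f.hasCompactSupport_normed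
  have hψ : ∀ δ : ℝ, 0 < δ → ∃ ψ : SchwartzMap ℝ ℂ, ∀ x, ψ x = ((δ⁻¹ * φ (x / δ) : ℝ) : ℂ) := by
    intro δ hδ
    have h1 : HasCompactSupport fun x : ℝ => ((δ⁻¹ * φ (x / δ) : ℝ) : ℂ) := by
      have h := hφs.comp_homeomorph (Homeomorph.mulRight₀ δ⁻¹ (inv_ne_zero hδ.ne'))
      have h2 := h.comp_left (g := fun y : ℝ => ((δ⁻¹ * y : ℝ) : ℂ)) (by simp)
      exact h2
    have h2 : ContDiff ℝ (⊤ : ℕ∞) fun x : ℝ => ((δ⁻¹ * φ (x / δ) : ℝ) : ℂ) :=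
      Complex.ofRealCLM.contDiff.comp
        (contDiff_const.mul (hφc.comp (contDiff_id.div_const δ)))
    exact ⟨h1.toSchwartzMap h2, fun x => rfl⟩
  obtain ⟨ψ₁, hψ₁⟩ := hψ 1 one_pos
  simp only [inv_one, one_mul, div_one] at hψ₁
  have hF : ∀ η : ℝ, (𝓕 ψ₁) η = ∫ v : ℝ, Complex.exp (↑(-2 * Real.pi * v * η) * Complex.I) *
      (φ v : ℂ) := fun η => by
    rw [SchwartzMap.fourier_coe, Real.fourier_real_eq_integral_exp_smul]
    simp [hψ₁]
  have hA := (𝓕 ψ₁).one_add_le_sup_seminorm_apply (𝕜 := ℝ) (m := (2, 0)) (k := 2) (n := 0)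
    le_rfl le_rfl
  simp only [norm_iteratedFDeriv_zero] at hA
  set A := 2 ^ 2 * ((Finset.Iic (2, 0)).sup fun m => SchwartzMap.seminorm ℝ m.1 m.2) (𝓕 ψ₁)
  refine ⟨φ, fun η => (𝓕 ψ₁) η, A, hφc.continuous, fun x => f.nonneg_normed x, fun x hx => ?_,
    f.integral_normed, ?_, ?_, fun η => ?_, fun δ hδ x => ?_⟩
  · have : x ∉ Function.support φ := by
      rw [f.support_normed_eq]
      simpa [f] using hx.le
    simpa using this
  · simp only [hF]
    simp only [mul_zero, Complex.ofReal_zero, zero_mul, Complex.exp_zero, one_mul]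
    rw [integral_complex_ofReal, f.integral_normed, Complex.ofReal_one]
  · exact le_trans (by positivity) (hA 0)
  · rw [← div_eq_mul_inv, le_div_iff₀' (by positivity)]
    simpa using hA η
  · obtain ⟨ψ, hψδ⟩ := hψ δ hδ
    have h := ψ.tsum_eq_tsum_fourier x
    simp only [hψδ] at h
    rw [h]
    refine tsum_congr fun n => ?_
    rw [fourier_coe_apply]
    congr 1
    · simp only [hF]
      rw [SchwartzMap.fourier_coe, Real.fourier_real_eq_integral_exp_smul]
      simp only [hψδ, smul_eq_mul]
      have h1 := Measure.integral_comp_div (fun v : ℝ =>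
        Complex.exp (↑(-2 * Real.pi * v * (δ * n)) * Complex.I) * (φ v : ℂ)) δ
      rw [abs_of_pos hδ] at h1
      rw [← inv_smul_smul₀ hδ.ne' (∫ v : ℝ, Complex.exp (_ * Complex.I) * (φ v : ℂ)), ← h1,
        ← integral_smul]
      refine integral_congr_ae (ae_of_all _ fun v => ?_)
      have e : (-2 : ℝ) * Real.pi * (v / δ) * (δ * n) = -2 * Real.pi * v * n := by
        field_simp
      simp only [e, Complex.real_smul, Complex.ofReal_mul]
      ring
    · push_cast; simp

/-- The product kernel `∏ δ⁻¹ φ((yᵢ - xᵢ)/δ)`. -/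
noncomputable def productBump (φ : ℝ → ℝ) (δ : ℝ) {N : ℕ} (y x : EuclideanSpace ℝ (Fin N)) : ℝ :=
  ∏ i, (δ⁻¹ * φ ((y i - x i) / δ))

section productBump

variable {N : ℕ} {φ : ℝ → ℝ} {δ : ℝ}

lemma continuous_productBump (hφ : Continuous φ) (y : EuclideanSpace ℝ (Fin N)) :
    Continuous (productBump φ δ y) := by
  unfold productBump
  fun_prop

lemma productBump_nonneg (hφ : ∀ x, 0 ≤ φ x) (hδ : 0 < δ) (y x : EuclideanSpace ℝ (Fin N)) :
    0 ≤ productBump φ δ y x :=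
  prod_nonneg fun _ _ => mul_nonneg (by positivity) (hφ _)

lemma productBump_eq_zero (hφ : ∀ x, (1 / N : ℝ) < |x| → φ x = 0) (hδ : 0 < δ)
    {y x : EuclideanSpace ℝ (Fin N)} (h : δ < ‖y - x‖) : productBump φ δ y x = 0 := by
  by_contra hne
  rw [productBump, ← ne_eq, prod_ne_zero_iff] at hne
  have hle : ∀ i, |y i - x i| ≤ δ / N := by
    intro i
    by_contra! hlt
    refine hne i (mem_univ i) ?_
    rw [hφ, mul_zero]
    rwa [abs_div, abs_of_pos hδ, lt_div_iff₀ hδ, one_div_mul_eq_div]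
  refine h.not_ge ?_
  rw [EuclideanSpace.norm_eq]
  refine Real.sqrt_le_iff.mpr ⟨hδ.le, ?_⟩
  rcases Nat.eq_zero_or_pos N with rfl | hN
  · simp [sq_nonneg]
  have hN1 : (1 : ℝ) ≤ N := by exact_mod_cast hN
  calc ∑ i, ‖(y - x) i‖ ^ 2 ≤ ∑ _i : Fin N, (δ / N) ^ 2 := by
        gcongr with i
        simpa using hle i
    _ = δ ^ 2 / N := by
        rw [sum_const, card_univ, Fintype.card_fin, nsmul_eq_mul]
        field_simp
    _ ≤ δ ^ 2 := div_le_self (sq_nonneg _) hN1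

lemma integral_productBump (hφ : ∫ x, φ x = 1) (hδ : 0 < δ) (y : EuclideanSpace ℝ (Fin N)) :
    ∫ x, productBump φ δ y x = 1 := by
  have h1 : ∀ z : ℝ, ∫ t, δ⁻¹ * φ ((z - t) / δ) = 1 := by
    intro z
    rw [integral_const_mul, integral_sub_left_eq_self (fun t => φ (t / δ)),
      Measure.integral_comp_div, hφ, abs_of_pos hδ]
    simp [hδ.ne']
  rw [← (EuclideanSpace.volume_preserving_symm_measurableEquiv_toLp
    (Fin N)).symm.integral_comp']
  simp only [productBump]
  have := integral_fintype_prod_volume_eq_prod (𝕜 := ℝ) (ι := Fin N)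
    (fun i t => δ⁻¹ * φ ((y i - t) / δ))
  simp only [h1, prod_const_one] at this
  exact this

lemma integrable_mul_productBump (hφ : Continuous φ) (hφr : ∀ x, (1 / N : ℝ) < |x| → φ x = 0)
    (hδ : 0 < δ) {P : EuclideanSpace ℝ (Fin N) → ℝ} (hP : Continuous P)
    (y : EuclideanSpace ℝ (Fin N)) :
    Integrable fun x => P x * productBump φ δ y x := by
  refine (hP.mul (continuous_productBump hφ y)).integrable_of_hasCompactSupport
    (HasCompactSupport.intro (isCompact_closedBall y δ) fun x hx => ?_)
  rw [Metric.mem_closedBall, not_le, dist_eq_norm'] at hx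
  rw [Pi.mul_apply, productBump_eq_zero hφr hδ hx, mul_zero]

lemma abs_integral_mul_productBump_sub_le (hφ : Continuous φ) (hφ0 : ∀ x, 0 ≤ φ x)
    (hφr : ∀ x, (1 / N : ℝ) < |x| → φ x = 0) (hφ1 : ∫ x, φ x = 1) (hδ : 0 < δ)
    {P : EuclideanSpace ℝ (Fin N) → ℝ} (hP : Continuous P) (y : EuclideanSpace ℝ (Fin N)) {ε : ℝ}
    (hε : ∀ x, ‖y - x‖ ≤ δ → |P x - P y| ≤ ε) :
    |(∫ x, P x * productBump φ δ y x) - P y| ≤ ε := by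
  have h1 : P y = ∫ x, P y * productBump φ δ y x := by
    rw [integral_const_mul, integral_productBump hφ1 hδ, mul_one]
  have h2 : ε = ∫ x, ε * productBump φ δ y x := by
    rw [integral_const_mul, integral_productBump hφ1 hδ, mul_one]
  rw [h1, ← integral_sub (integrable_mul_productBump hφ hφr hδ hP y)
    (integrable_mul_productBump hφ hφr hδ continuous_const y), h2, ← Real.norm_eq_abs]
  refine norm_integral_le_of_norm_le (integrable_mul_productBump hφ hφr hδ continuous_const y)
    (ae_of_all _ fun x => ?_)
  rw [← sub_mul, norm_mul, Real.norm_eq_abs, Real.norm_eq_abs,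
    abs_of_nonneg (productBump_nonneg hφ0 hδ y x)]
  by_cases hx : ‖y - x‖ ≤ δ
  · exact mul_le_mul_of_nonneg_right (hε x hx) (productBump_nonneg hφ0 hδ y x)
  · rw [productBump_eq_zero hφr hδ (not_le.mp hx), mul_zero, mul_zero]

end productBump

lemma finite_and_card_shifted_lattice_le {N : ℕ} (ρ : EuclideanSpace ℝ (Fin N)) {R : ℝ}
    (hR : 1 ≤ R) : ∃ T : Finset (Fin N → ℤ),
      (∀ b : Fin N → ℤ, b ∈ T ↔ ‖WithLp.toLp 2 (fun i => (b i : ℝ) + ρ i)‖ ≤ R) ∧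
      (T.card : ℝ) ≤ (3 * R) ^ N := by
  classical
  let U : Finset (Fin N → ℤ) := Fintype.piFinset fun i => Finset.Icc ⌈-R - ρ i⌉ ⌊R - ρ i⌋
  have hU : (U.card : ℝ) ≤ (3 * R) ^ N := by
    have h : ∀ i : Fin N, ((Finset.Icc ⌈-R - ρ i⌉ ⌊R - ρ i⌋).card : ℝ) ≤ 3 * R := by
      intro i
      rw [Int.card_Icc]
      have h1 := Int.floor_le (R - ρ i)
      have h2 := Int.le_ceil (-R - ρ i)
      rcases le_total 0 (⌊R - ρ i⌋ + 1 - ⌈-R - ρ i⌉) with h | h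
      · have : (((⌊R - ρ i⌋ + 1 - ⌈-R - ρ i⌉).toNat : ℤ) : ℝ) =
          ((⌊R - ρ i⌋ + 1 - ⌈-R - ρ i⌉ : ℤ) : ℝ) := by rw [Int.toNat_of_nonneg h]
        rw [Int.cast_natCast] at this
        rw [this]
        push_cast
        linarith
      · rw [Int.toNat_of_nonpos h]
        simp only [Nat.cast_zero]
        linarith
    rw [Fintype.card_piFinset]
    push_cast
    calc _ ≤ ∏ _i : Fin N, (3 * R) := prod_le_prod (fun _ _ => by positivity) fun i _ => h i
      _ = _ := by simp
  refine ⟨U.filter fun b => ‖WithLp.toLp 2 (fun i => (b i : ℝ) + ρ i)‖ ≤ R, fun b => ?_, ?_⟩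
  · rw [mem_filter, and_iff_right_iff_imp]
    intro hb
    refine Fintype.mem_piFinset.mpr fun i => ?_
    have h := abs_le.mp ((PiLp.norm_apply_le
      (WithLp.toLp 2 fun i => (b i : ℝ) + ρ i : EuclideanSpace ℝ (Fin N)) i).trans hb)
    simp only at h
    rw [Finset.mem_Icc, Int.ceil_le, Int.le_floor]
    constructor <;> linarith [h.1, h.2]
  · exact le_trans (by exact_mod_cast card_filter_le _ _) hU

lemma setIntegral_closedBall_smul {N : ℕ} {F : Type*} [NormedAddCommGroup F] [NormedSpace ℝ F]
    (f : EuclideanSpace ℝ (Fin N) → F) {R : ℝ} (hR : 0 < R) :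
    ∫ x in Metric.closedBall 0 R, f x = R ^ N • ∫ x in Metric.closedBall 0 1, f (R • x) := by
  rw [Measure.setIntegral_comp_smul_of_pos _ _ _ hR, smul_unitClosedBall_of_nonneg hR.le,
    finrank_euclideanSpace_fin, smul_inv_smul₀ (pow_ne_zero _ hR.ne')]

lemma rpow_norm_le_prod_rpow {N : ℕ} (hN : 0 < N) (ξ : Fin N → ℤ) (hξ : ξ ≠ 0) {a : ℝ}
    (ha : 0 ≤ a) :
    1 ≤ ‖(WithLp.toLp 2 fun i => (ξ i : ℝ) : EuclideanSpace ℝ (Fin N))‖ ∧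
    ‖(WithLp.toLp 2 fun i => (ξ i : ℝ) : EuclideanSpace ℝ (Fin N))‖ ^ (-a) ≤
      2 ^ a * ∏ i, (1 + |(ξ i : ℝ)|) ^ (-(a / N)) := by
  set x : EuclideanSpace ℝ (Fin N) := WithLp.toLp 2 fun i => (ξ i : ℝ) with hx
  have hi : ∀ i, |(ξ i : ℝ)| ≤ ‖x‖ := fun i => PiLp.norm_apply_le x i
  have h1 : 1 ≤ ‖x‖ := by
    obtain ⟨i, hi0⟩ := Function.ne_iff.mp hξ
    refine le_trans ?_ (hi i)
    exact_mod_cast Int.one_le_abs hi0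
  refine ⟨h1, ?_⟩
  have hx0 : 0 < ‖x‖ := by linarith
  have hN' : (N : ℝ) ≠ 0 := by exact_mod_cast hN.ne'
  calc ‖x‖ ^ (-a) = 2 ^ a * (2 * ‖x‖) ^ (-a) := by
        rw [Real.mul_rpow (by norm_num) hx0.le, ← mul_assoc, ← Real.rpow_add (by norm_num)]
        simp
    _ = 2 ^ a * ∏ _i : Fin N, (2 * ‖x‖) ^ (-(a / N)) := by
        rw [prod_const, card_univ, Fintype.card_fin, ← Real.rpow_mul_natCast (by positivity)]
        congr 2
        field_simp
    _ ≤ _ := by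
        refine mul_le_mul_of_nonneg_left (prod_le_prod (fun i _ => by positivity) fun i _ => ?_)
          (by positivity)
        exact Real.rpow_le_rpow_of_nonpos (by positivity) (by linarith [hi i])
          (neg_nonpos.mpr (by positivity))

lemma exists_norm_fourier_closedBall_smul_le {ι : Type*} (n : ℕ) (s : Finset ι)
    (v : ι → EuclideanSpace ℝ (Fin (n + 1))) :
    ∃ C, 0 ≤ C ∧ ∀ R : ℝ, 1 ≤ R → ∀ ξ : Fin (n + 1) → ℤ, ξ ≠ 0 →
      ‖∫ x in Metric.closedBall 0 R, ((∏ i ∈ s, inner ℝ (v i) x : ℝ) : ℂ) *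
        Complex.exp (-(∑ i, 2 * Real.pi * ξ i * x i : ℝ) * Complex.I)‖ ≤
      C * R ^ ((#s + (n + 1) : ℝ) - (n + 2) / 2) *
        ∏ i, (1 + |(ξ i : ℝ)|) ^ (-(((n + 2 : ℝ) / 2) / (n + 1 : ℕ))) := by
  obtain ⟨C, hC0, hC⟩ := exists_norm_fourier_closedBall_le n s v
  refine ⟨C * 2 ^ ((n + 2 : ℝ) / 2), by positivity, fun R hR ξ hξ => ?_⟩
  have hR0 : 0 < R := by linarith
  set a : ℝ := (n + 2 : ℝ) / 2 with ha
  have ha0 : 0 ≤ a := by positivity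
  obtain ⟨h1, h2⟩ := rpow_norm_le_prod_rpow n.succ_pos ξ hξ ha0
  set x₀ : EuclideanSpace ℝ (Fin (n + 1)) := WithLp.toLp 2 fun i => (ξ i : ℝ) with hx₀
  have hpi : 1 ≤ 2 * Real.pi * R := by nlinarith [Real.pi_gt_three]
  have hη : ‖(2 * Real.pi * R) • x₀‖ = 2 * Real.pi * R * ‖x₀‖ := by
    rw [norm_smul, Real.norm_of_nonneg (by positivity)]
  have key := hC ((2 * Real.pi * R) • x₀) (by rw [hη]; nlinarith)
  rw [hη] at key
  rw [setIntegral_closedBall_smul _ hR0]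
  have hin : ∀ x : EuclideanSpace ℝ (Fin (n + 1)),
      ((∏ i ∈ s, inner ℝ (v i) (R • x) : ℝ) : ℂ) *
        Complex.exp (-(∑ i, 2 * Real.pi * ξ i * (R • x) i : ℝ) * Complex.I) =
      (R ^ #s : ℝ) * (((∏ i ∈ s, inner ℝ (v i) x : ℝ) : ℂ) *
        Complex.exp (-(inner ℝ ((2 * Real.pi * R) • x₀) x : ℝ) * Complex.I)) := by
    intro x
    have e1 : ∏ i ∈ s, inner ℝ (v i) (R • x) = R ^ #s * ∏ i ∈ s, inner ℝ (v i) x := by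
      simp only [real_inner_smul_right, prod_mul_distrib, prod_const]
    have e2 : ∑ i, 2 * Real.pi * ξ i * (R • x) i = inner ℝ ((2 * Real.pi * R) • x₀) x := by
      rw [real_inner_smul_left, PiLp.inner_apply, mul_sum]
      refine sum_congr rfl fun i _ => ?_
      simp [hx₀]
      ring
    rw [e1, e2, Complex.ofReal_mul, mul_assoc]
  simp only [hin]
  rw [integral_const_mul, norm_smul, norm_mul, Complex.norm_real, Real.norm_of_nonneg (by positivity),
    Real.norm_of_nonneg (by positivity)]
  calc _ ≤ R ^ (n + 1) * (R ^ #s * (C * (R ^ (-a) * (2 ^ a *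
        ∏ i, (1 + |(ξ i : ℝ)|) ^ (-(a / (n + 1 : ℕ))))))) := by
        gcongr
        refine key.trans ?_
        gcongr
        calc _ ≤ (R * ‖x₀‖) ^ (-a) := by
              refine Real.rpow_le_rpow_of_nonpos (by positivity) ?_ (by linarith)
              gcongr
              nlinarith [Real.pi_gt_three]
          _ = R ^ (-a) * ‖x₀‖ ^ (-a) := Real.mul_rpow hR0.le (norm_nonneg _)
          _ ≤ _ := by gcongr
    _ = _ := by
        have : R ^ ((#s + (n + 1) : ℝ) - a) = R ^ #s * R ^ (n + 1) * R ^ (-a) := by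
          rw [← Real.rpow_natCast, ← Real.rpow_natCast, ← Real.rpow_add hR0, ← Real.rpow_add hR0]
          push_cast
          ring_nf
        rw [this]
        ring

section Homogeneous

variable {N D : ℕ} {P : EuclideanSpace ℝ (Fin N) → ℝ}

lemma setIntegral_closedBall_homogeneous (hP : ∀ (t : ℝ) x, P (t • x) = t ^ D * P x) {R : ℝ}
    (hR : 0 < R) :
    ∫ x in Metric.closedBall 0 R, P x = R ^ (D + N) * ∫ x in Metric.closedBall 0 1, P x := by
  rw [setIntegral_closedBall_smul _ hR]
  simp only [hP]
  rw [integral_const_mul, smul_eq_mul, pow_add]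
  ring

lemma exists_abs_sub_le_of_homogeneous (hP : ∀ (t : ℝ) x, P (t • x) = t ^ D * P x)
    (hPc : ContDiff ℝ 1 P) : ∃ L : ℝ, 0 ≤ L ∧ ∀ R : ℝ, 1 ≤ R → ∀ x y, ‖x‖ ≤ 2 * R →
      ‖y‖ ≤ 2 * R → |P x - P y| ≤ L * (R ^ D * (‖x - y‖ / R)) := by
  obtain ⟨K, hK⟩ := hPc.contDiffOn.exists_lipschitzOnWith one_ne_zero
    (convex_closedBall (0 : EuclideanSpace ℝ (Fin N)) 2) (isCompact_closedBall _ _)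
  refine ⟨K, K.2, fun R hR x y hx hy => ?_⟩
  have hR0 : 0 < R := by linarith
  have hb : ∀ z : EuclideanSpace ℝ (Fin N), ‖z‖ ≤ 2 * R → R⁻¹ • z ∈ Metric.closedBall 0 2 := by
    intro z hz
    rw [mem_closedBall_zero_iff, norm_smul, Real.norm_of_nonneg (by positivity),
      inv_mul_le_iff₀ hR0]
    linarith
  have h := hK.dist_le_mul _ (hb x hx) _ (hb y hy)
  have e : ∀ z, P z = R ^ D * P (R⁻¹ • z) := fun z => by
    rw [← hP, smul_inv_smul₀ hR0.ne']
  rw [dist_smul₀, Real.norm_of_nonneg (by positivity), Real.dist_eq, dist_eq_norm] at h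
  rw [e x, e y, ← mul_sub, abs_mul, abs_of_pos (by positivity)]
  calc _ ≤ R ^ D * (K * (R⁻¹ * ‖x - y‖)) := by gcongr
    _ = _ := by ring

end Homogeneous

lemma exists_abs_sum_mollified_sub_le {ι : Type*} (n : ℕ) (hn : 1 ≤ n) (s : Finset ι)
    (v : ι → EuclideanSpace ℝ (Fin (n + 1))) (ρ : EuclideanSpace ℝ (Fin (n + 1)))
    {φ : ℝ → ℝ} {c : ℝ → ℂ} {A : ℝ} (hφ : Continuous φ)
    (hφr : ∀ x, (1 / (n + 1 : ℕ) : ℝ) < |x| → φ x = 0) (hc0 : c 0 = 1) (hA : 0 ≤ A)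
    (hcA : ∀ η, ‖c η‖ ≤ A * ((1 + |η|) ^ 2)⁻¹)
    (hP : ∀ δ : ℝ, 0 < δ → ∀ x : ℝ, ∑' n : ℤ, ((δ⁻¹ * φ ((x + n) / δ) : ℝ) : ℂ) =
        ∑' n : ℤ, c (δ * n) * Complex.exp (2 * Real.pi * Complex.I * n * x)) :
    ∃ C, 0 ≤ C ∧ ∀ R δ : ℝ, 1 ≤ R → 0 < δ → δ ≤ 1 → ∀ T : Finset (Fin (n + 1) → ℤ),
      (∀ b : Fin (n + 1) → ℤ, ‖WithLp.toLp 2 (fun i => (b i : ℝ) + ρ i)‖ ≤ R + δ → b ∈ T) →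
      |∑ b ∈ T, (∫ x in Metric.closedBall 0 R, (∏ i ∈ s, inner ℝ (v i) x) *
          productBump φ δ (WithLp.toLp 2 fun i => (b i : ℝ) + ρ i) x) -
        R ^ (#s + (n + 1)) * ∫ x in Metric.closedBall 0 1, ∏ i ∈ s, inner ℝ (v i) x| ≤
      C * (R ^ ((#s + (n + 1) : ℝ) - (n + 2) / 2) * δ ^ (-(n : ℝ) / 2)) := by
  obtain ⟨C, hC0, hC⟩ := exists_norm_fourier_closedBall_smul_le n s v
  have hn' : (1 : ℝ) ≤ n := by exact_mod_cast hn
  set β : ℝ := ((n + 2 : ℝ) / 2) / (n + 1 : ℕ) with hβ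
  have hβ0 : 0 < β := by positivity
  have hβ1 : β < 1 := by
    rw [hβ, div_lt_one (by positivity)]
    push_cast
    linarith
  have h1β : 0 < 1 - β := by linarith
  refine ⟨C * A ^ (n + 1) * (1 + 2 / (1 - β)) ^ (n + 1), by positivity,
    fun R δ hR hδ hδ1 T hT => ?_⟩
  have hR0 : 0 < R := by linarith
  have hPc : Continuous fun x => ∏ i ∈ s, inner ℝ (v i) x := by fun_prop
  have hb : ∀ b : Fin (n + 1) → ℤ, ∀ x : EuclideanSpace ℝ (Fin (n + 1)),
      productBump φ δ (WithLp.toLp 2 fun i => (b i : ℝ) + ρ i) x =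
        ∏ i, (δ⁻¹ * φ ((ρ i - x i + b i) / δ)) := fun b x => by
    unfold productBump
    refine prod_congr rfl fun i _ => ?_
    congr 3
    ring
  have key := abs_sum_integral_mollified_sub_integral_le hφr hc0 hA hcA hδ hδ1 (hP δ hδ) ρ
    (S := Metric.closedBall 0 R) measurableSet_closedBall
    (f := fun x => ∏ i ∈ s, inner ℝ (v i) x)
    (hPc.continuousOn.integrableOn_compact (isCompact_closedBall _ _)) T (fun b hbT x hx => by
      rw [← hb]
      refine productBump_eq_zero hφr hδ ?_
      by_contra! hle
      refine hbT (hT b ?_)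
      have := norm_add_le (WithLp.toLp 2 (fun i => (b i : ℝ) + ρ i) - x) x
      rw [sub_add_cancel] at this
      rw [mem_closedBall_zero_iff] at hx
      linarith) (fun b _ => by
        simp only [← hb]
        exact (integrable_mul_productBump hφ hφr hδ hPc _).integrableOn)
    hβ0 hβ1 (K := C * R ^ ((#s + (n + 1) : ℝ) - (n + 2) / 2)) (by positivity) (hC R hR)
  simp only [← hb] at key
  rw [setIntegral_closedBall_homogeneous (D := #s) (fun t x => by
    simp only [real_inner_smul_right, prod_mul_distrib, prod_const]) hR0] at key
  refine key.trans (le_of_eq ?_)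
  have e : (δ ^ (β - 1)) ^ (n + 1) = δ ^ (-(n : ℝ) / 2) := by
    rw [← Real.rpow_mul_natCast hδ.le]
    congr 1
    rw [hβ]
    push_cast
    field_simp
    ring
  rw [mul_pow, e]
  ring

lemma sum_le_sum_mollified_add {N : ℕ} {φ : ℝ → ℝ} {δ R ε : ℝ} (hφ : Continuous φ)
    (hφ0 : ∀ x, 0 ≤ φ x) (hφr : ∀ x, (1 / N : ℝ) < |x| → φ x = 0) (hφ1 : ∫ x, φ x = 1)
    (hδ : 0 < δ) {P : EuclideanSpace ℝ (Fin N) → ℝ} (hP : Continuous P) (hP0 : ∀ x, 0 ≤ P x)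
    {α : Type*} (y : α → EuclideanSpace ℝ (Fin N)) {T U : Finset α} (hTU : T ⊆ U)
    (hT : ∀ b ∈ T, ‖y b‖ ≤ R) (hε : ∀ x z, ‖z‖ ≤ R → ‖z - x‖ ≤ δ → |P x - P z| ≤ ε) :
    ∑ b ∈ T, P (y b) ≤ ∑ b ∈ U, (∫ x in Metric.closedBall 0 (R + δ),
      P x * productBump φ δ (y b) x) + #T * ε := by
  calc ∑ b ∈ T, P (y b) ≤ ∑ b ∈ T, ((∫ x in Metric.closedBall 0 (R + δ),
        P x * productBump φ δ (y b) x) + ε) := by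
        refine sum_le_sum fun b hb => ?_
        rw [setIntegral_eq_integral_of_forall_compl_eq_zero]
        · have := (abs_le.mp (abs_integral_mul_productBump_sub_le hφ hφ0 hφr hφ1 hδ hP (y b)
            fun x hx => hε x (y b) (hT b hb) hx)).1
          linarith
        · intro x hx
          rw [mem_closedBall_zero_iff, not_le] at hx
          rw [productBump_eq_zero hφr hδ, mul_zero]
          have := norm_sub_norm_le x (y b)
          rw [norm_sub_rev] at this
          linarith [hT b hb]
    _ = ∑ b ∈ T, (∫ x in Metric.closedBall 0 (R + δ), P x * productBump φ δ (y b) x) +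
        #T * ε := by rw [sum_add_distrib, sum_const, nsmul_eq_mul]
    _ ≤ _ := by
        gcongr
        exact fun b _ _ => setIntegral_nonneg measurableSet_closedBall fun x _ =>
          mul_nonneg (hP0 x) (productBump_nonneg hφ0 hδ _ _)

lemma sum_mollified_le_sum_add {N : ℕ} {φ : ℝ → ℝ} {δ R ε : ℝ} (hφ : Continuous φ)
    (hφ0 : ∀ x, 0 ≤ φ x) (hφr : ∀ x, (1 / N : ℝ) < |x| → φ x = 0) (hφ1 : ∫ x, φ x = 1)
    (hδ : 0 < δ) {P : EuclideanSpace ℝ (Fin N) → ℝ} (hP : Continuous P) (hP0 : ∀ x, 0 ≤ P x)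
    {α : Type*} (y : α → EuclideanSpace ℝ (Fin N)) {T : Finset α}
    (hT : ∀ b ∈ T, ‖y b‖ ≤ R) (hε : ∀ x z, ‖z‖ ≤ R → ‖z - x‖ ≤ δ → |P x - P z| ≤ ε)
    (S : Set (EuclideanSpace ℝ (Fin N))) :
    ∑ b ∈ T, (∫ x in S, P x * productBump φ δ (y b) x) ≤ ∑ b ∈ T, P (y b) + #T * ε := by
  rw [← nsmul_eq_mul, ← sum_const, ← sum_add_distrib]
  refine sum_le_sum fun b hb => ?_
  have h1 := (abs_le.mp (abs_integral_mul_productBump_sub_le hφ hφ0 hφr hφ1 hδ hP (y b)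
    fun x hx => hε x (y b) (hT b hb) hx)).2
  have h2 := setIntegral_le_integral (s := S) (integrable_mul_productBump hφ hφr hδ hP (y b))
    (ae_of_all _ fun x => mul_nonneg (hP0 x) (productBump_nonneg hφ0 hδ _ _))
  linarith

/-- Lattice points of a shifted lattice in a ball of radius `R`, counted with a nonnegative
weight that is a product of linear forms. -/
theorem exists_abs_sum_lattice_sub_le {ι : Type*} (n : ℕ) (hn : 1 ≤ n) (s : Finset ι)
    (v : ι → EuclideanSpace ℝ (Fin (n + 1))) (hv : ∀ x, 0 ≤ ∏ i ∈ s, inner ℝ (v i) x)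
    (ρ : EuclideanSpace ℝ (Fin (n + 1))) :
    ∃ C, ∀ R : ℝ, 2 ≤ R → ∀ T : Finset (Fin (n + 1) → ℤ),
      (∀ b : Fin (n + 1) → ℤ, b ∈ T ↔ ‖WithLp.toLp 2 (fun i => (b i : ℝ) + ρ i)‖ ≤ R) →
      |∑ b ∈ T, ∏ i ∈ s, inner ℝ (v i) (WithLp.toLp 2 fun i => (b i : ℝ) + ρ i) -
        R ^ (#s + (n + 1)) * ∫ x in Metric.closedBall 0 1, ∏ i ∈ s, inner ℝ (v i) x| ≤
      C * R ^ ((#s : ℝ) + n * (n + 1) / (n + 2)) := by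
  obtain ⟨φ, c, A, hφ, hφ0, hφr, hφ1, hc0, hA, hcA, hpoisson⟩ :=
    exists_poisson_kernel (r := 1 / (n + 1 : ℕ)) (by positivity)
  obtain ⟨C, hC0, hC⟩ := exists_abs_sum_mollified_sub_le n hn s v ρ hφ hφr hc0 hA hcA hpoisson
  obtain ⟨P, hP⟩ : ∃ P : EuclideanSpace ℝ (Fin (n + 1)) → ℝ,
    P = fun x => ∏ i ∈ s, inner ℝ (v i) x := ⟨_, rfl⟩
  have hPx : ∀ x, ∏ i ∈ s, inner ℝ (v i) x = P x := fun x => by rw [hP]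
  simp only [hPx] at hC hv ⊢
  have hPhom : ∀ (t : ℝ) x, P (t • x) = t ^ #s * P x := fun t x => by
    simp only [hP, real_inner_smul_right, prod_mul_distrib, prod_const]
  have hPd : ContDiff ℝ 1 P := by
    rw [hP]
    exact contDiff_prod fun i _ => contDiff_const.inner ℝ contDiff_id
  obtain ⟨L, hL0, hL⟩ := exists_abs_sub_le_of_homogeneous hPhom hPd
  set J := ∫ x in Metric.closedBall 0 1, P x
  have hJ : 0 ≤ J := setIntegral_nonneg measurableSet_closedBall fun x _ => hv x
  set q : ℕ := #s + (n + 1) with hq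
  set e : ℝ := (#s + (n + 1) : ℝ) - (n + 2) / 2 with he
  have hn' : (1 : ℝ) ≤ n := by exact_mod_cast hn
  have he0 : 0 ≤ e := by
    have : (0 : ℝ) ≤ #s := by positivity
    rw [he]; linarith
  refine ⟨q * 2 ^ (q - 1) * J + C * 2 ^ e + 3 ^ (n + 1) * L, fun R hR T hT => ?_⟩
  have hR0 : 0 < R := by linarith
  set δ : ℝ := R ^ (-(n / (n + 2)) : ℝ) with hδ
  have hδ0 : 0 < δ := by positivity
  have hδ1 : δ ≤ 1 := Real.rpow_le_one_of_one_le_of_nonpos (by linarith)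
    (neg_nonpos.mpr (by positivity))
  set X : ℝ := R ^ ((#s : ℝ) + n * (n + 1) / (n + 2)) with hX
  have hX1 : R ^ (q - 1) * δ = X := by
    rw [← Real.rpow_natCast, hδ, ← Real.rpow_add hR0, hX, hq, ← add_assoc, Nat.add_sub_cancel]
    congr 1
    push_cast
    field_simp
    ring
  have hX2 : R ^ e * δ ^ (-(n : ℝ) / 2) = X := by
    rw [hδ, ← Real.rpow_mul hR0.le, ← Real.rpow_add hR0, hX, he]
    congr 1
    field_simp
    ring
  have hpow : ∀ R', 0 ≤ R' → R' ≤ 2 * R → |R' - R| ≤ δ →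
      |R' ^ q * J - R ^ q * J| ≤ q * 2 ^ (q - 1) * J * X := by
    intro R' hR' h2 hd
    rw [← sub_mul, abs_mul, abs_of_nonneg hJ]
    calc |R' ^ q - R ^ q| * J ≤ δ * q * (2 * R) ^ (q - 1) * J := by
          gcongr
          refine (abs_pow_sub_pow_le _ _ _).trans ?_
          rw [abs_of_nonneg hR', abs_of_pos hR0]
          gcongr
          exact max_le h2 (by linarith)
      _ = _ := by rw [← hX1, mul_pow]; ring
  have hmain : ∀ R', 1 ≤ R' → R' ≤ 2 * R →
      C * (R' ^ e * δ ^ (-(n : ℝ) / 2)) ≤ C * 2 ^ e * X := by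
    intro R' h1 h2
    rw [mul_assoc]
    refine mul_le_mul_of_nonneg_left ?_ hC0
    calc R' ^ e * δ ^ (-(n : ℝ) / 2) ≤ (2 * R) ^ e * δ ^ (-(n : ℝ) / 2) := by gcongr
      _ = _ := by rw [Real.mul_rpow (by norm_num) hR0.le, mul_assoc, hX2]
  have hε : ∀ x z : EuclideanSpace ℝ (Fin (n + 1)), ‖z‖ ≤ R → ‖z - x‖ ≤ δ →
      |P x - P z| ≤ L * (R ^ #s * (δ / R)) := by
    intro x z hz hzx
    have h := norm_sub_norm_le x z
    rw [norm_sub_rev] at h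
    refine (hL R (by linarith) x z (by linarith) (by linarith)).trans ?_
    rw [norm_sub_rev]
    gcongr
  have hcard : #T * (L * (R ^ #s * (δ / R))) ≤ 3 ^ (n + 1) * L * X := by
    obtain ⟨T', hT', hcard⟩ := finite_and_card_shifted_lattice_le ρ (by linarith : 1 ≤ R)
    rw [show T' = T by ext b; rw [hT, hT']] at hcard
    calc _ ≤ (3 * R) ^ (n + 1) * (L * (R ^ #s * (δ / R))) := by gcongr
      _ = _ := by
        rw [← hX1, hq, ← add_assoc, Nat.add_sub_cancel, pow_add]
        field_simp
        ring
  obtain ⟨U, hU, -⟩ := finite_and_card_shifted_lattice_le ρ (by linarith : 1 ≤ R + δ + δ)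
  have hup := by
    have h1 := sum_le_sum_mollified_add hφ hφ0 hφr hφ1 hδ0 hPd.continuous hv
      (fun b : Fin (n + 1) → ℤ => WithLp.toLp 2 fun i => (b i : ℝ) + ρ i) (T := T) (U := U)
      (fun b hb => (hU b).mpr (((hT b).mp hb).trans (by linarith))) (fun b hb => (hT b).mp hb) hε
    exact h1.trans (add_le_add_left (sub_le_iff_le_add'.mp ((abs_le.mp (hC (R + δ) δ (by linarith)
      hδ0 hδ1 U fun b => (hU b).mpr)).2)) _)
  have hlow := by
    have h1 := sum_mollified_le_sum_add hφ hφ0 hφr hφ1 hδ0 hPd.continuous hv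
      (fun b : Fin (n + 1) → ℤ => WithLp.toLp 2 fun i => (b i : ℝ) + ρ i) (T := T)
      (fun b hb => (hT b).mp hb) hε (Metric.closedBall 0 (R - δ))
    exact le_trans (neg_le_sub_iff_le_add.mp ((abs_le.mp (hC (R - δ) δ (by linarith)
      hδ0 hδ1 T fun b hb => (hT b).mpr (by linarith))).1)) (add_le_add_left h1 _)
  have h1 := (abs_le.mp (hpow (R + δ) (by linarith) (by linarith) (by
    rw [add_sub_cancel_left, abs_of_pos hδ0]))).2
  have h2 := (abs_le.mp (hpow (R - δ) (by linarith) (by linarith) (by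
    rw [sub_sub_cancel_left, abs_neg, abs_of_pos hδ0]))).1
  have h3 := hmain (R + δ) (by linarith) (by linarith)
  have h4 := hmain (R - δ) (by linarith) (by linarith)
  rw [abs_le]
  constructor <;> linarith

lemma card_filter_fst_lt_snd_mul_two (N : ℕ) :
    #(univ.filter fun p : Fin N × Fin N => p.1 < p.2) * 2 = N * (N - 1) := by
  have h : #(univ.filter fun p : Fin N × Fin N => p.1 < p.2) = ∑ j : Fin N, (j : ℕ) := by
    rw [card_filter, ← univ_product_univ, sum_product_right]
    refine sum_congr rfl fun j _ => ?_
    rw [← card_filter, ← Fin.card_Iio j]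
    congr 1
    ext i
    simp
  rw [h, Fin.sum_univ_eq_sum_range (fun j => j), sum_range_id_mul_two]

lemma exists_linear_forms_multiplicity (N : ℕ) (m : EuclideanSpace ℝ (Fin N) → ℝ)
    (hm : ∀ x, m x =
      ∏ p ∈ Finset.univ.filter (fun p : Fin N × Fin N => p.1 < p.2),
        ((x p.1 - x p.2) ^ 2 / (((p.2 : ℕ) : ℝ) - ((p.1 : ℕ) : ℝ)) ^ 2)) :
    ∃ (s : Finset ((Fin N × Fin N) × Fin 2))
      (v : (Fin N × Fin N) × Fin 2 → EuclideanSpace ℝ (Fin N)),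
      #s = N * (N - 1) ∧ (∀ x, ∏ i ∈ s, inner ℝ (v i) x = m x) ∧ ∀ x, 0 ≤ m x := by
  refine ⟨univ.filter (fun p : Fin N × Fin N => p.1 < p.2) ×ˢ univ, fun i =>
    (((i.1.2 : ℕ) : ℝ) - ((i.1.1 : ℕ) : ℝ))⁻¹ •
      (EuclideanSpace.single i.1.1 1 - EuclideanSpace.single i.1.2 1), ?_, fun x => ?_,
    fun x => ?_⟩
  · rw [card_product, card_univ, Fintype.card_fin, card_filter_fst_lt_snd_mul_two]
  · rw [hm, prod_product]
    refine prod_congr rfl fun p _ => ?_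
    simp only [prod_const, card_univ, Fintype.card_fin, real_inner_smul_left, inner_sub_left,
      EuclideanSpace.inner_single_left, map_one, one_mul]
    rw [mul_pow, inv_pow, div_eq_inv_mul]
  · rw [hm]
    exact prod_nonneg fun p _ => by positivity

/-- **Improved Weyl law for the unitary group U(N), N ≥ 2 (Theorem 4.2, first part).**
With `d = dim U(N) = N²`, `ρ_j = (N+1)/2 − j` the half-sum of positive roots,
the multiplicity polynomial `m(x) = ∏_{j<k}(x_j−x_k)²/(k−j)²` and the spectral counting
function `𝓝(λ) = (N!)⁻¹ Σ_{b∈ℤᴺ} m(b+ρ) 1_{|b+ρ|² ≤ λ+|ρ|²}`, one has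
`𝓝(λ) = C λ^{d/2} + O(λ^{N(N+2)(N−1)/(2(N+1))})` with `C = (N!)⁻¹ ∫_{|x|≤1} m`;
in particular the exponent is `< (d−1)/2`, so the Avakumovic–Hörmander remainder
exponent is not sharp. -/
theorem stmt6 (N : ℕ) (hN : 2 ≤ N) (d : ℕ) (hd : d = N ^ 2)
    (ρ : EuclideanSpace ℝ (Fin N))
    (hρ : ∀ j : Fin N, ρ j = ((N : ℝ) + 1) / 2 - ((j : ℕ) + 1))
    (m : EuclideanSpace ℝ (Fin N) → ℝ)
    (hm : ∀ x, m x =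
      ∏ p ∈ Finset.univ.filter (fun p : Fin N × Fin N => p.1 < p.2),
        ((x p.1 - x p.2) ^ 2 / (((p.2 : ℕ) : ℝ) - ((p.1 : ℕ) : ℝ)) ^ 2))
    (𝓝 : ℝ → ℝ)
    (h𝓝 : ∀ lam : ℝ, 𝓝 lam = (1 / (N.factorial : ℝ)) *
      ∑' b : Fin N → ℤ,
        if ‖((EuclideanSpace.equiv (Fin N) ℝ).symm fun i => (b i : ℝ) + ρ i)‖ ^ 2
            ≤ lam + ‖ρ‖ ^ 2 then
          m ((EuclideanSpace.equiv (Fin N) ℝ).symm fun i => (b i : ℝ) + ρ i) else 0)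
    (C α : ℝ)
    (hC : C = (1 / (N.factorial : ℝ)) *
      ∫ x in Metric.closedBall (0 : EuclideanSpace ℝ (Fin N)) 1, m x)
    (hα : α = (N : ℝ) * ((N : ℝ) + 2) * ((N : ℝ) - 1) / (2 * ((N : ℝ) + 1))) :
    (fun lam : ℝ => 𝓝 lam - C * lam ^ ((d : ℝ) / 2)) =O[atTop] (fun lam => lam ^ α)
      ∧ α < ((d : ℝ) - 1) / 2 := by
  have hN2 : (2 : ℝ) ≤ N := by exact_mod_cast hN
  have hdN : (d : ℝ) = (N : ℝ) ^ 2 := by rw [hd]; push_cast; rfl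
  refine ⟨?_, ?_⟩
  swap
  · rw [hα, hdN, div_lt_div_iff₀ (by positivity) (by norm_num)]
    nlinarith
  obtain ⟨s, v, hs, hv, hm0⟩ := exists_linear_forms_multiplicity N m hm
  obtain ⟨n, rfl⟩ : ∃ n, N = n + 1 := ⟨N - 1, by omega⟩
  obtain ⟨C₀, hC₀⟩ := exists_abs_sum_lattice_sub_le n (by omega) s v
    (fun x => (hm0 x).trans_eq (hv x).symm) ρ
  simp only [hv] at hC₀
  have hsd : #s + (n + 1) = d := by rw [hs, hd, Nat.add_sub_cancel]; ring
  have hexp : (#s : ℝ) + n * (n + 1) / (n + 2) = 2 * α := by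
    rw [hs, hα, Nat.add_sub_cancel]
    push_cast
    field_simp
    ring
  rw [hsd, hexp] at hC₀
  set J := ∫ x in Metric.closedBall (0 : EuclideanSpace ℝ (Fin (n + 1))) 1, m x
  have hα0 : 0 ≤ α := by
    rw [hα]
    exact div_nonneg (mul_nonneg (by positivity) (by linarith)) (by positivity)
  have hdα : ((d - 2 : ℕ) : ℝ) ≤ 2 * α := by
    have h2d : 2 ≤ d := by rw [hd]; nlinarith
    rw [Nat.cast_sub h2d, hdN, hα, mul_div_assoc', le_div_iff₀ (by positivity)]
    push_cast
    nlinarith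
  set B := ‖ρ‖ ^ 2
  have hB : 0 ≤ B := by positivity
  refine IsBigO.of_bound ((1 / ((n + 1).factorial : ℝ)) * (C₀ + B * d * |J|) * (1 + B) ^ α) ?_
  filter_upwards [eventually_ge_atTop 4] with lam hlam
  have hlam0 : 0 < lam := by linarith
  set R := √(lam + B) with hR
  set r := √lam with hr
  have hR2 : R ^ 2 = lam + B := Real.sq_sqrt (by positivity)
  have hr2 : r ^ 2 = lam := Real.sq_sqrt hlam0.le
  have hr0 : 2 ≤ r := Real.le_sqrt_of_sq_le (by linarith)
  have hrR : r ≤ R := Real.sqrt_le_sqrt (by linarith)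
  obtain ⟨T, hT, -⟩ := finite_and_card_shifted_lattice_le ρ (by linarith : 1 ≤ R)
  have hsum : 𝓝 lam = (1 / ((n + 1).factorial : ℝ)) *
      ∑ b ∈ T, m (WithLp.toLp 2 fun i => (b i : ℝ) + ρ i) := by
    have hiff : ∀ b : Fin (n + 1) → ℤ, (‖((EuclideanSpace.equiv (Fin (n + 1)) ℝ).symm
        fun i => (b i : ℝ) + ρ i)‖ ^ 2 ≤ lam + B) ↔ b ∈ T := fun b => by
      rw [hT, ← hR2]
      exact pow_le_pow_iff_left₀ (norm_nonneg _) (by linarith) two_ne_zero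
    rw [h𝓝]
    simp only [hiff]
    rw [tsum_eq_sum (s := T) fun b hb => if_neg hb]
    congr 1
    exact sum_congr rfl fun b hb => if_pos hb
  have hlamd : lam ^ ((d : ℝ) / 2) = r ^ d := by
    rw [← Real.rpow_natCast, hr, Real.sqrt_eq_rpow, ← Real.rpow_mul hlam0.le]
    congr 1
    ring
  have hRα : R ^ (2 * α) ≤ (1 + B) ^ α * lam ^ α := by
    rw [Real.rpow_mul (by linarith), Real.rpow_two, hR2, ← Real.mul_rpow (by positivity) hlam0.le]
    refine Real.rpow_le_rpow (by positivity) ?_ hα0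
    nlinarith
  have hpow : |R ^ d - r ^ d| ≤ B * d * R ^ (2 * α) := by
    have hsub : |R - r| * R ≤ B := by
      rw [abs_of_nonneg (by linarith)]
      nlinarith
    have h2d : d - 1 = d - 2 + 1 := by
      have : 2 ≤ d := by rw [hd]; nlinarith
      omega
    calc |R ^ d - r ^ d| ≤ |R - r| * d * max |R| |r| ^ (d - 1) := abs_pow_sub_pow_le _ _ _
      _ = |R - r| * R * d * R ^ ((d - 2 : ℕ) : ℝ) := by
        rw [abs_of_nonneg (by linarith : 0 ≤ R), abs_of_nonneg (by linarith : 0 ≤ r),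
          max_eq_left hrR, h2d, Real.rpow_natCast]
        ring
      _ ≤ B * d * R ^ (2 * α) := by
        gcongr
        linarith
  have hmain := hC₀ R (by linarith) T hT
  have hfac : (0 : ℝ) < 1 / ((n + 1).factorial : ℝ) := by positivity
  rw [hsum, hC, hlamd, mul_assoc, ← mul_sub, norm_mul, Real.norm_of_nonneg hfac.le,
    Real.norm_eq_abs, Real.norm_of_nonneg (by positivity)]
  simp only [mul_assoc]
  refine mul_le_mul_of_nonneg_left ?_ hfac.le
  have hcoef : 0 ≤ C₀ + B * (d * |J|) := by
    have : 0 ≤ C₀ := by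
      by_contra! h
      have := mul_neg_of_neg_of_pos h (Real.rpow_pos_of_pos (by linarith : 0 < R) (2 * α))
      linarith [abs_nonneg (∑ b ∈ T, m (WithLp.toLp 2 fun i => (b i : ℝ) + ρ i) - R ^ d * J)]
    positivity
  calc |∑ b ∈ T, m (WithLp.toLp 2 fun i => (b i : ℝ) + ρ i) - J * r ^ d|
      ≤ |∑ b ∈ T, m (WithLp.toLp 2 fun i => (b i : ℝ) + ρ i) - R ^ d * J| +
        |R ^ d - r ^ d| * |J| := by
        rw [← abs_mul]
        refine le_trans (le_of_eq ?_) (abs_add_le _ _)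
        congr 1
        ring
    _ ≤ C₀ * R ^ (2 * α) + B * d * R ^ (2 * α) * |J| := by gcongr
    _ = (C₀ + B * (d * |J|)) * R ^ (2 * α) := by ring
    _ ≤ _ := mul_le_mul_of_nonneg_left hRα hcoef
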